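/- arXiv:2304.10797 — 14 statements merged into one kernel-verified Lean document; each statement's English description precedes it below -/
import Mathlib

section
/- For every a ∈ ℝ, the limit lim_{x→∞} K₀(x; a)/K₀(x) = 0 holds. -/
open Real MeasureTheory

/-- `K₀(x) = ∫₀^∞ exp(-x cosh T) dT` for `x > 0` (the Lean integral is `0` at `x = 0`,
matching the convention `K₀(0) := 0`). -/
noncomputable def K0 (x : ℝ) : ℝ := ∫ T in Set.Ioi (0:ℝ), Real.exp (-x * Real.cosh T)

/-- The incomplete version `K₀(x; a) = sgn(a) ∫_{|a|}^∞ exp(-x cosh T) dT`. -/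
noncomputable def K0inc (x a : ℝ) : ℝ :=
  Real.sign a * ∫ T in Set.Ioi |a|, Real.exp (-x * Real.cosh T)

lemma K0_aux_int (x : ℝ) (hx : 1 ≤ x) :
    IntegrableOn (fun T => Real.exp (-x * Real.cosh T)) (Set.Ioi (0:ℝ)) := by
  have h := exp_neg_integrableOn_Ioi (0:ℝ) (one_pos)
  refine Integrable.mono' h (Continuous.aestronglyMeasurable (by fun_prop)) ?_
  filter_upwards [ae_restrict_mem measurableSet_Ioi] with T hT
  rw [Real.norm_eq_abs, abs_of_pos (Real.exp_pos _)]
  apply Real.exp_le_exp.mpr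
  have h1 : T ≤ Real.sinh T := Real.self_le_sinh_iff.mpr (le_of_lt hT)
  have h2 := Real.sinh_lt_cosh T
  nlinarith [Real.one_le_cosh T]

lemma K0_aux_den (x b : ℝ) (hx : 1 ≤ x) (hb : 0 < b) :
    b * Real.exp (-x * Real.cosh b) ≤ K0 x := by
  have h1 : ∫ T in Set.Ioc 0 b, Real.exp (-x * Real.cosh T) ≤ K0 x := by
    refine setIntegral_mono_set (K0_aux_int x hx) ?_ ?_
    · exact Filter.Eventually.of_forall fun T => (Real.exp_pos _).le
    · exact Filter.Eventually.of_forall fun T hT => hT.1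
  have h2 : ∫ T in Set.Ioc 0 b, Real.exp (-x * Real.cosh b)
      ≤ ∫ T in Set.Ioc 0 b, Real.exp (-x * Real.cosh T) := by
    refine setIntegral_mono_on (by simp) ((K0_aux_int x hx).mono_set fun T hT => hT.1)
      measurableSet_Ioc ?_
    intro T hT
    apply Real.exp_le_exp.mpr
    have : Real.cosh T ≤ Real.cosh b := by
      rw [Real.cosh_le_cosh, abs_of_pos hT.1, abs_of_pos hb]; exact hT.2
    nlinarith
  have h3 : ∫ T in Set.Ioc 0 b, Real.exp (-x * Real.cosh b) = b * Real.exp (-x * Real.cosh b) := by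
    simp [hb.le]
  linarith

lemma K0_aux_num (x b : ℝ) (hx : 1 ≤ x) (hb : 0 < b) :
    ∫ T in Set.Ioi b, Real.exp (-x * Real.cosh T) ≤
      Real.exp (-(x - 1) * Real.cosh b) * ∫ T in Set.Ioi b, Real.exp (-1 * Real.cosh T) := by
  rw [← integral_const_mul]
  have hs : Set.Ioi b ⊆ Set.Ioi 0 := Set.Ioi_subset_Ioi hb.le
  refine setIntegral_mono_on ((K0_aux_int x hx).mono_set hs)
    (((K0_aux_int 1 le_rfl).mono_set hs).const_mul _) measurableSet_Ioi ?_
  intro T hT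
  rw [← Real.exp_add]
  apply Real.exp_le_exp.mpr
  have hT' : b < T := hT
  have : Real.cosh b ≤ Real.cosh T := by
    rw [Real.cosh_le_cosh, abs_of_pos hb, abs_of_pos (hb.trans hT')]; exact hT'.le
  nlinarith

/-- For every `a ∈ ℝ`, `lim_{x→∞} K₀(x;a)/K₀(x) = 0`. -/
theorem K0inc_div_K0_tendsto_zero (a : ℝ) :
    Filter.Tendsto (fun x : ℝ => K0inc x a / K0 x) Filter.atTop (nhds 0) := by
  rcases eq_or_ne a 0 with rfl | ha
  · simp [K0inc]
  have hb : 0 < |a| := abs_pos.mpr ha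
  set b := |a| with hbdef
  set C := ∫ T in Set.Ioi b, Real.exp (-1 * Real.cosh T) with hC
  have hC0 : 0 ≤ C := integral_nonneg fun T => (Real.exp_pos _).le
  have hc : 0 < Real.cosh b - Real.cosh (b / 2) := by
    rw [sub_pos, Real.cosh_lt_cosh, abs_of_pos hb, abs_of_pos (half_pos hb)]; linarith
  have hlim : Filter.Tendsto (fun x : ℝ => (C * Real.exp (Real.cosh b) / (b / 2)) *
      Real.exp (-((Real.cosh b - Real.cosh (b / 2)) * x))) Filter.atTop (nhds 0) := by
    have := (Real.tendsto_exp_neg_atTop_nhds_zero.comp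
      (Filter.tendsto_id.const_mul_atTop hc)).const_mul (C * Real.exp (Real.cosh b) / (b / 2))
    simpa [Function.comp_def] using this
  refine squeeze_zero_norm' ?_ hlim
  filter_upwards [Filter.eventually_ge_atTop (1:ℝ)] with x hx
  have hd := K0_aux_den x (b / 2) hx (half_pos hb)
  have hdp : 0 < b / 2 * Real.exp (-x * Real.cosh (b / 2)) := by positivity
  have hn := K0_aux_num x b hx hb
  have hn0 : 0 ≤ ∫ T in Set.Ioi b, Real.exp (-x * Real.cosh T) :=
    integral_nonneg fun T => (Real.exp_pos _).le
  have hs : |Real.sign a| ≤ 1 := by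
    rcases Real.sign_apply_eq a with h | h | h <;> simp [h]
  have hN : |K0inc x a| ≤ Real.exp (-(x - 1) * Real.cosh b) * C := by
    unfold K0inc
    rw [abs_mul, ← hbdef, abs_of_nonneg hn0]
    calc _ ≤ 1 * _ := mul_le_mul_of_nonneg_right hs hn0
      _ ≤ _ := by rw [one_mul]; exact hn
  rw [norm_div, Real.norm_eq_abs, Real.norm_eq_abs, abs_of_pos (hdp.trans_le hd)]
  calc _ ≤ Real.exp (-(x - 1) * Real.cosh b) * C / (b / 2 * Real.exp (-x * Real.cosh (b / 2))) :=
        div_le_div₀ (by positivity) hN hdp hd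
    _ = _ := by
      rw [div_eq_iff hdp.ne']
      have : Real.exp (-(x - 1) * Real.cosh b) = Real.exp (Real.cosh b) *
        Real.exp (-((Real.cosh b - Real.cosh (b / 2)) * x)) * Real.exp (-x * Real.cosh (b / 2)) := by
        rw [← Real.exp_add, ← Real.exp_add]; congr 1; ring
      rw [this]
      field_simp
end

section
/- The function K₀ satisfies the modified Bessel differential equation of order zero: for every x > 0, x·K₀''(x) + K₀'(x) − x·K₀(x) = 0. -/
open Real MeasureTheory

lemma K0aux_bound (n : ℕ) (x : ℝ) (hx : 0 < x) (T : ℝ) :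
    Real.cosh T ^ n * Real.exp (-x * Real.cosh T)
      ≤ (2 * ((n + 1).factorial : ℝ) / x ^ (n + 1)) * Real.exp (-T) := by
  have hc := Real.cosh_pos T
  have h1 := Real.pow_div_factorial_le_exp (x * Real.cosh T) (by positivity) (n + 1)
  have hf : (0:ℝ) < ((n + 1).factorial : ℝ) := by positivity
  rw [div_le_iff₀ hf] at h1
  have h2 : Real.exp T ≤ 2 * Real.cosh T := by
    rw [Real.cosh_eq]; have := Real.exp_pos (-T); linarith
  have e1 : Real.exp (-x * Real.cosh T) = (Real.exp (x * Real.cosh T))⁻¹ := by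
    rw [← Real.exp_neg]; ring_nf
  rw [e1, Real.exp_neg T, ← div_eq_mul_inv, ← div_eq_mul_inv, div_div,
    div_le_div_iff₀ (Real.exp_pos _) (by positivity)]
  calc Real.cosh T ^ n * (x ^ (n + 1) * Real.exp T)
      ≤ Real.cosh T ^ n * (x ^ (n + 1) * (2 * Real.cosh T)) := by gcongr
    _ = 2 * (x * Real.cosh T) ^ (n + 1) := by rw [mul_pow, pow_succ (Real.cosh T)]; ring
    _ ≤ 2 * (Real.exp (x * Real.cosh T) * ((n + 1).factorial : ℝ)) := by gcongr
    _ = _ := by ring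

lemma K0aux_int (n : ℕ) (x : ℝ) (hx : 0 < x) :
    IntegrableOn (fun T => Real.cosh T ^ n * Real.exp (-x * Real.cosh T)) (Set.Ioi 0) := by
  refine Integrable.mono' ((integrableOn_exp_neg_Ioi 0).const_mul
    (2 * ((n + 1).factorial : ℝ) / x ^ (n + 1))) ?_ ?_
  · exact Continuous.aestronglyMeasurable (by fun_prop)
  · refine Filter.Eventually.of_forall fun T => ?_
    have hc := Real.cosh_pos T
    rw [Real.norm_of_nonneg (by positivity)]
    exact K0aux_bound n x hx T

lemma K0aux_deriv (n : ℕ) (x : ℝ) (hx : 0 < x) :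
    HasDerivAt (fun y => ∫ T in Set.Ioi (0:ℝ), Real.cosh T ^ n * Real.exp (-y * Real.cosh T))
      (-∫ T in Set.Ioi (0:ℝ), Real.cosh T ^ (n + 1) * Real.exp (-x * Real.cosh T)) x := by
  have h := hasDerivAt_integral_of_dominated_loc_of_deriv_le
    (μ := volume.restrict (Set.Ioi (0:ℝ)))
    (F := fun y T => Real.cosh T ^ n * Real.exp (-y * Real.cosh T))
    (F' := fun y T => -(Real.cosh T ^ (n + 1) * Real.exp (-y * Real.cosh T)))
    (bound := fun T => Real.cosh T ^ (n + 1) * Real.exp (-(x / 2) * Real.cosh T))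
    (Ioi_mem_nhds (half_lt_self hx))
    (Filter.Eventually.of_forall fun y => Continuous.aestronglyMeasurable (by fun_prop))
    (K0aux_int n x hx)
    (Continuous.aestronglyMeasurable (by fun_prop))
    (Filter.Eventually.of_forall fun T y hy => ?_)
    (K0aux_int (n + 1) (x / 2) (half_pos hx))
    (Filter.Eventually.of_forall fun T y hy => ?_)
  · have := h.2
    rwa [integral_neg] at this
  · have hc := Real.cosh_pos T
    have hy' : x / 2 < y := hy
    rw [norm_neg, Real.norm_of_nonneg (by positivity)]
    gcongr
  · have h1 : HasDerivAt (fun y : ℝ => -y * Real.cosh T) (-1 * Real.cosh T) y :=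
      ((hasDerivAt_id y).neg).mul_const _
    refine (h1.exp.const_mul (Real.cosh T ^ n)).congr_deriv ?_
    ring

lemma K0aux_ibp (x : ℝ) (hx : 0 < x) :
    ∫ T in Set.Ioi (0:ℝ), (Real.cosh T ^ 1 * Real.exp (-x * Real.cosh T)
      - x * (Real.cosh T ^ 2 * Real.exp (-x * Real.cosh T))
      + x * (Real.cosh T ^ 0 * Real.exp (-x * Real.cosh T))) = 0 := by
  have h := integral_Ioi_of_hasDerivAt_of_tendsto' (a := (0:ℝ)) (m := 0)
    (f := fun T => Real.sinh T * Real.exp (-x * Real.cosh T))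
    (f' := fun T => Real.cosh T ^ 1 * Real.exp (-x * Real.cosh T)
      - x * (Real.cosh T ^ 2 * Real.exp (-x * Real.cosh T))
      + x * (Real.cosh T ^ 0 * Real.exp (-x * Real.cosh T)))
    (fun T _ => ?_)
    (((K0aux_int 1 x hx).sub ((K0aux_int 2 x hx).const_mul x)).add
      ((K0aux_int 0 x hx).const_mul x)) ?_
  · simpa using h
  · refine ((Real.hasDerivAt_sinh T).mul
      (((Real.hasDerivAt_cosh T).const_mul (-x)).exp)).congr_deriv ?_
    rw [Real.cosh_sq T]
    ring
  · refine squeeze_zero_norm (a := fun T => (2 * ((1 + 1).factorial : ℝ) / x ^ (1 + 1)) *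
      Real.exp (-T)) (fun T => ?_) ?_
    · refine le_trans ?_ (K0aux_bound 1 x hx T)
      rw [norm_mul, Real.norm_of_nonneg (Real.exp_pos _).le, pow_one]
      gcongr
      rw [Real.norm_eq_abs, abs_le, Real.cosh_eq, Real.sinh_eq]
      have := Real.exp_pos T
      have := Real.exp_pos (-T)
      constructor <;> linarith
    · have h0 := Real.tendsto_exp_neg_atTop_nhds_zero.const_mul
        (2 * ((1 + 1).factorial : ℝ) / x ^ (1 + 1))
      rw [mul_zero] at h0
      exact h0

/-- `K₀` satisfies the modified Bessel equation of order zero: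
`x K₀''(x) + K₀'(x) − x K₀(x) = 0` for `x > 0`. -/
theorem K0_bessel_ode (x : ℝ) (hx : 0 < x) :
    x * deriv (deriv K0) x + deriv K0 x - x * K0 x = 0 := by
  have hK : K0 = fun y => ∫ T in Set.Ioi (0:ℝ), Real.cosh T ^ 0 * Real.exp (-y * Real.cosh T) := by
    funext y; simp [K0]
  have hd : ∀ y, 0 < y → deriv K0 y =
      -∫ T in Set.Ioi (0:ℝ), Real.cosh T ^ 1 * Real.exp (-y * Real.cosh T) := by
    intro y hy
    rw [hK]
    exact (K0aux_deriv 0 y hy).deriv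
  have hdd : deriv (deriv K0) x =
      ∫ T in Set.Ioi (0:ℝ), Real.cosh T ^ 2 * Real.exp (-x * Real.cosh T) := by
    have he : deriv K0 =ᶠ[nhds x] fun y =>
        -∫ T in Set.Ioi (0:ℝ), Real.cosh T ^ 1 * Real.exp (-y * Real.cosh T) := by
      filter_upwards [Ioi_mem_nhds hx] with y hy using hd y hy
    rw [he.deriv_eq]
    refine (K0aux_deriv 1 x hx).neg.deriv.trans ?_
    rw [neg_neg]
  have h := K0aux_ibp x hx
  have hs : IntegrableOn (fun T => Real.cosh T ^ 1 * Real.exp (-x * Real.cosh T)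
      - x * (Real.cosh T ^ 2 * Real.exp (-x * Real.cosh T))) (Set.Ioi 0) :=
    (K0aux_int 1 x hx).sub ((K0aux_int 2 x hx).const_mul x)
  rw [integral_add hs
      ((K0aux_int 0 x hx).const_mul x),
    integral_sub (K0aux_int 1 x hx) ((K0aux_int 2 x hx).const_mul x),
    integral_const_mul, integral_const_mul] at h
  rw [hdd, hd x hx, hK]
  linarith
end

section
/- For every w = (w₁,w₂) ∈ ℝ² with w₁·w₂ ≠ 0 and every t₀ > 0, one has β_{t₀}(w) = (1/2)·K₀(2π|Q₀(w)|; log(t₀²·|w₂/w₁|)). -/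
open Real MeasureTheory

/-- The hyperbolic quadratic form `Q₀((x₁,x₂)) = x₁x₂` on `ℝ²`. -/
def Q0 (w : ℝ × ℝ) : ℝ := w.1 * w.2

/-- `λ_t⁺ = (λ₁ t⁻¹ + λ₂ t)/2`. -/
noncomputable def lamP (w : ℝ × ℝ) (t : ℝ) : ℝ := (w.1 / t + w.2 * t) / 2

/-- `λ_t⁻ = (−λ₁ t⁻¹ + λ₂ t)/2`. -/
noncomputable def lamM (w : ℝ × ℝ) (t : ℝ) : ℝ := (-w.1 / t + w.2 * t) / 2

/-- Zwegers' function `β_{t₀}(w)`. -/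
noncomputable def betaF (t₀ : ℝ) (w : ℝ × ℝ) : ℝ :=
  if 0 < lamM w t₀ * lamP w t₀ then
    Real.exp (-(2 * π * Q0 w)) * ∫ t in Set.Ioi t₀, Real.exp (-(4 * π * (lamM w t)^2)) / t
  else if lamM w t₀ * lamP w t₀ < 0 then
    -(Real.exp (-(2 * π * Q0 w)) * ∫ t in Set.Ioc (0:ℝ) t₀, Real.exp (-(4 * π * (lamM w t)^2)) / t)
  else 0

/-- The coefficient `a_λ(t₁,t₂)` (for `Q₀(λ) ≠ 0`). -/
noncomputable def aCoef (t₁ t₂ : ℝ) (w : ℝ × ℝ) : ℝ :=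
  if Q0 w < 0 then (1 - Real.sign (lamP w t₁ * lamP w t₂)) / 2
  else (1 - Real.sign (lamM w t₁ * lamM w t₂)) / 2

lemma aux_pt (w : ℝ × ℝ) (hw : w.1 * w.2 ≠ 0) (t : ℝ) (ht : 0 < t) :
    |2 / t| • Real.exp (-(2 * π * |Q0 w|) * Real.cosh (Real.log (t^2 * |w.2 / w.1|)))
      = 2 * (Real.exp (-(2 * π * Q0 w)) * (Real.exp (-(4 * π * (lamM w t)^2)) / t)) := by
  have h1 : w.1 ≠ 0 := left_ne_zero_of_mul hw
  have h2 : w.2 ≠ 0 := right_ne_zero_of_mul hw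
  have a1 : 0 < |w.1| := abs_pos.2 h1
  have a2 : 0 < |w.2| := abs_pos.2 h2
  have hc : 0 < t^2 * |w.2 / w.1| := by positivity
  rw [abs_of_pos (by positivity), smul_eq_mul, Real.cosh_log hc]
  have : Real.exp (-(2 * π * Q0 w)) * (Real.exp (-(4 * π * (lamM w t)^2)) / t)
      = Real.exp (-(2 * π * Q0 w) + -(4 * π * (lamM w t)^2)) / t := by
    rw [Real.exp_add]; ring
  rw [this]
  have e : -(2 * π * |Q0 w|) * ((t^2 * |w.2 / w.1| + (t^2 * |w.2 / w.1|)⁻¹) / 2)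
      = -(2 * π * Q0 w) + -(4 * π * (lamM w t)^2) := by
    have k1 : |Q0 w| * (t^2 * |w.2 / w.1|) = w.2^2 * t^2 := by
      unfold Q0
      rw [abs_mul, abs_div, ← sq_abs w.2]; field_simp
    have k2 : |Q0 w| * (t^2 * |w.2 / w.1|)⁻¹ = w.1^2 / t^2 := by
      unfold Q0
      rw [abs_mul, abs_div, ← sq_abs w.1]; field_simp
    have k3 : -(2 * π * |Q0 w|) * ((t^2 * |w.2 / w.1| + (t^2 * |w.2 / w.1|)⁻¹) / 2)
      = -π * (|Q0 w| * (t^2 * |w.2 / w.1|) + |Q0 w| * (t^2 * |w.2 / w.1|)⁻¹) := by ring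
    rw [k3, k1, k2]
    unfold Q0 lamM
    field_simp
    ring
  rw [e]; ring

lemma aux_int (w : ℝ × ℝ) (hw : w.1 * w.2 ≠ 0) (s : Set ℝ) (hs : MeasurableSet s)
    (hs0 : s ⊆ Set.Ioi 0) :
    Real.exp (-(2 * π * Q0 w)) * ∫ t in s, Real.exp (-(4 * π * (lamM w t)^2)) / t
     = (1/2) * ∫ T in (fun t => Real.log (t^2 * |w.2 / w.1|)) '' s,
        Real.exp (-(2 * π * |Q0 w|) * Real.cosh T) := by
  have h1 : w.1 ≠ 0 := left_ne_zero_of_mul hw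
  have h2 : w.2 ≠ 0 := right_ne_zero_of_mul hw
  have hc : 0 < |w.2 / w.1| := abs_pos.2 (div_ne_zero h2 h1)
  rw [integral_image_eq_integral_abs_deriv_smul (f' := fun t => 2 / t) hs, ]
  · rw [setIntegral_congr_fun hs (fun t ht => aux_pt w hw t (hs0 ht)), integral_const_mul,
      integral_const_mul]
    ring
  · intro x hx
    have hx0 : 0 < x := hs0 hx
    have : HasDerivAt (fun t : ℝ => t^2 * |w.2 / w.1|) (2 * x * |w.2 / w.1|) x := by
      simpa using (hasDerivAt_pow 2 x).mul_const (|w.2 / w.1|)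
    have h := (this.log (by positivity)).hasDerivWithinAt (s := s)
    have e : 2 * x * |w.2 / w.1| / (x ^ 2 * |w.2 / w.1|) = 2 / x := by
      generalize |w.2 / w.1| = c at *
      field_simp
    rw [e] at h
    exact h
  · intro x hx y hy hxy
    have hx0 : 0 < x := hs0 hx
    have hy0 : 0 < y := hs0 hy
    have := Real.log_injOn_pos (Set.mem_Ioi.2 (by positivity)) (Set.mem_Ioi.2 (by positivity)) hxy
    have := mul_right_cancel₀ hc.ne' this
    exact (pow_left_inj₀ hx0.le hy0.le (by norm_num)).1 this

lemma aux_surj (c : ℝ) (hc : 0 < c) (y : ℝ) : ∃ t, 0 < t ∧ Real.log (t^2 * c) = y := by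
  refine ⟨Real.sqrt (Real.exp y / c), by positivity, ?_⟩
  rw [Real.sq_sqrt (by positivity), div_mul_cancel₀ _ hc.ne', Real.log_exp]

lemma aux_lt (c : ℝ) (hc : 0 < c) (s t : ℝ) (hs : 0 < s) (ht : 0 < t) :
    Real.log (s^2 * c) < Real.log (t^2 * c) ↔ s < t := by
  rw [Real.log_lt_log_iff (by positivity) (by positivity), mul_lt_mul_iff_left₀ hc,
    pow_lt_pow_iff_left₀ hs.le ht.le (by norm_num)]

/-- For `w = (w₁,w₂)` with `w₁w₂ ≠ 0` and `t₀ > 0`: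
`β_{t₀}(w) = (1/2) K₀(2π|Q₀(w)|; log(t₀²|w₂/w₁|))`. -/
theorem betaF_eq_K0inc (w : ℝ × ℝ) (hw : w.1 * w.2 ≠ 0) (t₀ : ℝ) (ht₀ : 0 < t₀) :
    betaF t₀ w = (1/2) * K0inc (2 * π * |Q0 w|) (Real.log (t₀^2 * |w.2 / w.1|)) := by
  have h1 : w.1 ≠ 0 := left_ne_zero_of_mul hw
  have h2 : w.2 ≠ 0 := right_ne_zero_of_mul hw
  have a1 : 0 < |w.1| := abs_pos.2 h1
  have hc : 0 < |w.2 / w.1| := abs_pos.2 (div_ne_zero h2 h1)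
  have i1 : (fun t => Real.log (t^2 * |w.2 / w.1|)) '' Set.Ioi t₀
      = Set.Ioi (Real.log (t₀^2 * |w.2 / w.1|)) := by
    ext y
    constructor
    · rintro ⟨t, ht, rfl⟩
      exact (aux_lt _ hc _ _ ht₀ (ht₀.trans ht)).2 ht
    · intro hy
      obtain ⟨t, ht, rfl⟩ := aux_surj _ hc y
      exact ⟨t, (aux_lt _ hc _ _ ht₀ ht).1 hy, rfl⟩
  have i2 : (fun t => Real.log (t^2 * |w.2 / w.1|)) '' Set.Ioc 0 t₀
      = Set.Iic (Real.log (t₀^2 * |w.2 / w.1|)) := by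
    ext y
    constructor
    · rintro ⟨t, ht, rfl⟩
      exact not_lt.1 fun h => absurd ((aux_lt _ hc _ _ ht₀ ht.1).1 h) (not_lt.2 ht.2)
    · intro hy
      obtain ⟨t, ht, rfl⟩ := aux_surj _ hc y
      exact ⟨t, ⟨ht, not_lt.1 fun h => absurd ((aux_lt _ hc _ _ ht₀ ht).2 h) (not_lt.2 hy)⟩, rfl⟩
  have hp : 0 < t₀^2 * |w.2 / w.1| := by positivity
  have key : lamM w t₀ * lamP w t₀ = (w.1^2 / (4 * t₀^2)) * ((t₀^2 * |w.2 / w.1|)^2 - 1) := by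
    unfold lamM lamP
    rw [mul_pow, sq_abs]
    field_simp
    ring
  have hk : 0 < w.1^2 / (4 * t₀^2) := by positivity
  unfold betaF K0inc
  rw [aux_int w hw _ measurableSet_Ioi (fun t ht => ht₀.trans ht),
    aux_int w hw _ measurableSet_Ioc (fun t ht => ht.1), i1, i2, key]
  generalize t₀^2 * |w.2 / w.1| = u at *
  generalize w.1^2 / (4 * t₀^2) = k at *
  rcases lt_trichotomy u 1 with h | h | h
  · have hl := Real.log_neg hp h
    have hn : k * (u^2 - 1) < 0 := mul_neg_of_pos_of_neg hk (by nlinarith)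
    rw [if_neg (not_lt.2 hn.le), if_pos hn, Real.sign_of_neg hl, abs_of_neg hl,
      ← integral_comp_neg_Iic]
    simp only [Real.cosh_neg]
    ring
  · subst h
    simp
  · have hl := Real.log_pos h
    have hn : 0 < k * (u^2 - 1) := mul_pos hk (by nlinarith)
    rw [if_pos hn, Real.sign_of_pos hl, abs_of_pos hl, one_mul]
end

section
/- For every w ∈ ℝ² with Q₀(w) ≠ 0 and all 0 < t₁ < t₂, the identity e^{−2πQ₀(w)}·∫_{t₁}^{t₂} e^{−4π(w_t^−)²} dt/t = a_w(t₁,t₂)·K₀(2π|Q₀(w)|) + β_{t₁}(w) − β_{t₂}(w) holds. (This is the termwise identity underlying Zwegers' decomposition of the completed mock Maass theta function into a harmonic part and two non-harmonic parts.) -/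
open Real MeasureTheory

lemma mm_integrable (x : ℝ) (hx : 0 < x) :
    IntegrableOn (fun T => Real.exp (-x * Real.cosh T)) (Set.Ioi (0:ℝ)) := by
  refine Integrable.mono' (exp_neg_integrableOn_Ioi 0 hx) ?_ ?_
  · exact Continuous.aestronglyMeasurable (by fun_prop)
  · filter_upwards [ae_restrict_mem measurableSet_Ioi] with T hT
    rw [Real.norm_eq_abs, abs_of_pos (Real.exp_pos _), Real.exp_le_exp]
    have h1 : T ≤ Real.sinh T := Real.self_le_sinh_iff.2 (le_of_lt hT)
    have h2 := Real.sinh_lt_cosh T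
    nlinarith

/-- the common integrand -/
noncomputable def mmf (b c t : ℝ) : ℝ := Real.exp (-(π * b^2 * (c^4 / t^2 + t^2))) / t

lemma mm_subst (b c e T : ℝ) (hc : 0 < c) (he : e = 1 ∨ e = -1) :
    |c * (Real.exp (e * T / 2) * (e / 2))| • mmf b c (c * Real.exp (e * T / 2))
      = (1/2) * Real.exp (-(2 * π * (b^2*c^2)) * Real.cosh T) := by
  have hcosh : Real.cosh T = Real.cosh (e * T) := by
    rcases he with rfl | rfl <;> simp
  have habs : |e| = 1 := by rcases he with rfl | rfl <;> simp
  have hE := Real.exp_pos (e * T / 2)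
  have h1 : Real.exp (e * T) = Real.exp (e * T / 2) ^ 2 := by
    rw [← Real.exp_nat_mul]; congr 1; push_cast; ring
  rw [hcosh, Real.cosh_eq, Real.exp_neg, h1, mmf, smul_eq_mul, abs_mul, abs_mul, abs_div, habs,
    abs_of_pos hc, abs_of_pos hE]
  set E := Real.exp (e * T / 2) with hEdef
  have h2 : -(π * b^2 * (c^4 / (c * E)^2 + (c*E)^2))
      = -(2 * π * (b^2*c^2)) * ((E^2 + (E^2)⁻¹)/2) := by
    field_simp
    ring
  rw [h2]
  have : |(2:ℝ)| = 2 := by norm_num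
  rw [this]
  field_simp

lemma mm_half (b c e : ℝ) (hb : b ≠ 0) (hc : 0 < c) (he : e = 1 ∨ e = -1) (S : Set ℝ)
    (hS : (fun T => c * Real.exp (e * T / 2)) '' Set.Ioi 0 = S) :
    IntegrableOn (mmf b c) S ∧ ∫ t in S, mmf b c t = K0 (2 * π * (b^2*c^2)) / 2 := by
  have hx : 0 < 2 * π * (b^2*c^2) := by positivity
  have he0 : e ≠ 0 := by rcases he with rfl | rfl <;> norm_num
  have hd : ∀ T ∈ Set.Ioi (0:ℝ), HasDerivWithinAt (fun T => c * Real.exp (e * T / 2))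
      (c * (Real.exp (e * T / 2) * (e / 2))) (Set.Ioi 0) T := by
    intro T _
    have h : HasDerivAt (fun T : ℝ => e * T / 2) (e / 2) T := by
      simpa using ((hasDerivAt_id T).const_mul e).div_const 2
    exact ((h.exp).const_mul c).hasDerivWithinAt
  have hinj : Set.InjOn (fun T => c * Real.exp (e * T / 2)) (Set.Ioi 0) := by
    intro x _ y _ h
    have h := mul_left_cancel₀ hc.ne' h
    have h := Real.exp_injective h
    have : e * x = e * y := by linarith
    exact mul_left_cancel₀ he0 this
  rw [← hS]
  constructor
  · rw [integrableOn_image_iff_integrableOn_abs_deriv_smul measurableSet_Ioi hd hinj]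
    simp_rw [mm_subst b c e _ hc he]
    exact (mm_integrable _ hx).const_mul _
  · rw [integral_image_eq_integral_abs_deriv_smul measurableSet_Ioi hd hinj]
    simp_rw [mm_subst b c e _ hc he]
    rw [integral_const_mul, K0]
    ring

lemma mm_Ioi (b c : ℝ) (hb : b ≠ 0) (hc : 0 < c) :
    IntegrableOn (mmf b c) (Set.Ioi c) ∧
      ∫ t in Set.Ioi c, mmf b c t = K0 (2 * π * (b^2*c^2)) / 2 := by
  refine mm_half b c 1 hb hc (Or.inl rfl) _ ?_
  ext t
  simp only [Set.mem_image, Set.mem_Ioi]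
  constructor
  · rintro ⟨T, hT, rfl⟩
    have : 1 < Real.exp (1 * T / 2) := Real.one_lt_exp_iff.2 (by linarith)
    nlinarith
  · intro ht
    refine ⟨2 * Real.log (t / c), ?_, ?_⟩
    · have := Real.log_pos ((one_lt_div hc).2 ht)
      linarith
    · rw [show 1 * (2 * Real.log (t / c)) / 2 = Real.log (t/c) by ring,
        Real.exp_log (div_pos (hc.trans ht) hc)]
      field_simp

lemma mm_Ioc (b c : ℝ) (hb : b ≠ 0) (hc : 0 < c) :
    IntegrableOn (mmf b c) (Set.Ioc 0 c) ∧
      ∫ t in Set.Ioc 0 c, mmf b c t = K0 (2 * π * (b^2*c^2)) / 2 := by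
  rw [integrableOn_Ioc_iff_integrableOn_Ioo, integral_Ioc_eq_integral_Ioo]
  refine mm_half b c (-1) hb hc (Or.inr rfl) _ ?_
  ext t
  simp only [Set.mem_image, Set.mem_Ioi, Set.mem_Ioo]
  constructor
  · rintro ⟨T, hT, rfl⟩
    have : Real.exp (-1 * T / 2) < 1 := Real.exp_lt_one_iff.2 (by linarith)
    exact ⟨by positivity, by nlinarith⟩
  · rintro ⟨h0, ht⟩
    refine ⟨-2 * Real.log (t / c), ?_, ?_⟩
    · have := Real.log_neg (div_pos h0 hc) ((div_lt_one hc).2 ht)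
      linarith
    · rw [show -1 * (-2 * Real.log (t / c)) / 2 = Real.log (t/c) by ring,
        Real.exp_log (div_pos h0 hc)]
      field_simp

lemma mm_int (b c : ℝ) (hb : b ≠ 0) (hc : 0 < c) : IntegrableOn (mmf b c) (Set.Ioi 0) := by
  rw [← Set.Ioc_union_Ioi_eq_Ioi hc.le]
  exact (mm_Ioc b c hb hc).1.union (mm_Ioi b c hb hc).1

lemma mm_split (b c t : ℝ) (hb : b ≠ 0) (hc : 0 < c) (ht : 0 < t) :
    (∫ s in Set.Ioc 0 t, mmf b c s) + ∫ s in Set.Ioi t, mmf b c s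
      = ∫ s in Set.Ioi 0, mmf b c s := by
  have h := mm_int b c hb hc
  rw [← Set.Ioc_union_Ioi_eq_Ioi ht.le,
    setIntegral_union Set.Ioc_disjoint_Ioi_same measurableSet_Ioi
      (h.mono_set Set.Ioc_subset_Ioi_self) (h.mono_set (Set.Ioi_subset_Ioi ht.le))]

lemma mm_eq (w : ℝ × ℝ) (c e : ℝ) (he : e = 1 ∨ e = -1)
    (hw1 : w.1 = e * w.2 * c^2) (t : ℝ) (ht : t ≠ 0) :
    Real.exp (-(2 * π * Q0 w)) * (Real.exp (-(4 * π * (lamM w t)^2)) / t) = mmf w.2 c t := by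
  have he2 : e^2 = 1 := by rcases he with rfl | rfl <;> norm_num
  rw [mmf, ← mul_div_assoc, ← Real.exp_add]
  congr 2
  rw [Q0, lamM, hw1]
  field_simp
  linear_combination (-4*(w.2^2*c^4)) * he2

lemma mm_beta (w : ℝ × ℝ) (c e : ℝ) (he : e = 1 ∨ e = -1) (hb : w.2 ≠ 0) (hc : 0 < c)
    (hw1 : w.1 = e * w.2 * c^2) (t : ℝ) (ht : 0 < t) :
    betaF t w = (1 + Real.sign (t - c)) / 2 * K0 (2 * π * (w.2^2*c^2))
      - ∫ s in Set.Ioc 0 t, mmf w.2 c s := by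
  have he2 : e^2 = 1 := by rcases he with rfl | rfl <;> norm_num
  have hprod : lamM w t * lamP w t = (w.2^2 * (t + c) * (t^2+c^2) / (4*t^2)) * (t - c) := by
    rw [lamM, lamP, hw1]
    field_simp
    linear_combination (-4*(c^4)) * he2
  have hpos : 0 < w.2^2 * (t + c) * (t^2+c^2) / (4*t^2) := by positivity
  have hs := mm_split w.2 c t hb hc ht
  have hsc := mm_split w.2 c c hb hc hc
  rw [(mm_Ioc w.2 c hb hc).2, (mm_Ioi w.2 c hb hc).2] at hsc
  rw [betaF, hprod, ← integral_const_mul, ← integral_const_mul,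
    setIntegral_congr_fun (g := mmf w.2 c) measurableSet_Ioi
      (fun s hs => mm_eq w c e he hw1 s (ht.trans hs).ne'),
    setIntegral_congr_fun (g := mmf w.2 c) measurableSet_Ioc
      (fun s hs => mm_eq w c e he hw1 s hs.1.ne')]
  rcases lt_trichotomy t c with h | h | h
  · have h' : t - c < 0 := by linarith
    have hneg := mul_neg_of_pos_of_neg hpos h'
    rw [if_neg hneg.le.not_gt, if_pos hneg, Real.sign_of_neg h']
    ring
  · subst h
    rw [(mm_Ioc w.2 t hb hc).2]
    simp
    ring
  · have h' : 0 < t - c := by linarith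
    rw [if_pos (mul_pos hpos h'), Real.sign_of_pos h']
    linarith

lemma mm_sign_mul (p x : ℝ) (hp : 0 < p) : Real.sign (p * x) = Real.sign x := by
  rcases lt_trichotomy x 0 with h | h | h
  · rw [Real.sign_of_neg h, Real.sign_of_neg (mul_neg_of_pos_of_neg hp h)]
  · simp [h]
  · rw [Real.sign_of_pos h, Real.sign_of_pos (mul_pos hp h)]

lemma mm_a (w : ℝ × ℝ) (c e : ℝ) (he : e = 1 ∨ e = -1) (hb : w.2 ≠ 0) (hc : 0 < c)
    (hw1 : w.1 = e * w.2 * c^2) (t₁ t₂ : ℝ) (ht₁ : 0 < t₁) (ht₂ : 0 < t₂) :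
    aCoef t₁ t₂ w = (1 - Real.sign ((t₁ - c) * (t₂ - c))) / 2 := by
  have hpos : 0 < w.2^2 * (t₁ + c) * (t₂+c) / (4*t₁*t₂) := by positivity
  have hb2 : 0 < w.2^2 * c^2 := by positivity
  rw [← mm_sign_mul _ ((t₁ - c) * (t₂ - c)) hpos, aCoef]
  rcases he with rfl | rfl
  · rw [if_neg (by rw [Q0, hw1]; nlinarith)]
    congr 3
    rw [lamM, lamM, hw1]
    field_simp
    ring
  · rw [if_pos (by rw [Q0, hw1]; nlinarith)]
    congr 3
    rw [lamP, lamP, hw1]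
    field_simp
    ring

/-- The termwise identity underlying Zwegers' decomposition:
`e^{−2πQ₀(w)} ∫_{t₁}^{t₂} e^{−4π(w_t⁻)²} dt/t
  = a_w(t₁,t₂) K₀(2π|Q₀(w)|) + β_{t₁}(w) − β_{t₂}(w)`. -/
theorem mock_maass_termwise_decomposition (w : ℝ × ℝ) (hw : Q0 w ≠ 0)
    (t₁ t₂ : ℝ) (ht₁ : 0 < t₁) (ht₁₂ : t₁ < t₂) :
    Real.exp (-(2 * π * Q0 w)) * ∫ t in t₁..t₂, Real.exp (-(4 * π * (lamM w t)^2)) / t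
      = aCoef t₁ t₂ w * K0 (2 * π * |Q0 w|) + betaF t₁ w - betaF t₂ w := by
  have ht₂ : 0 < t₂ := ht₁.trans ht₁₂
  have ha : w.1 ≠ 0 := fun h => hw (by simp [Q0, h])
  have hb : w.2 ≠ 0 := fun h => hw (by simp [Q0, h])
  obtain ⟨c, e, hc, he, hw1⟩ : ∃ c e : ℝ, 0 < c ∧ (e = 1 ∨ e = -1) ∧ w.1 = e * w.2 * c^2 := by
    have hq : w.1 / w.2 ≠ 0 := div_ne_zero ha hb
    rcases hq.lt_or_gt with h | h
    · refine ⟨√(-(w.1/w.2)), -1, Real.sqrt_pos.2 (by linarith), Or.inr rfl, ?_⟩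
      rw [Real.sq_sqrt (by linarith)]
      field_simp
    · refine ⟨√(w.1/w.2), 1, Real.sqrt_pos.2 h, Or.inl rfl, ?_⟩
      rw [Real.sq_sqrt h.le]
      field_simp
  have hQ : |Q0 w| = w.2^2 * c^2 := by
    have hnn : 0 ≤ w.2^2*c^2 := by positivity
    rcases he with rfl | rfl
    · rw [Q0, hw1, show 1 * w.2 * c^2 * w.2 = w.2^2*c^2 by ring, abs_of_nonneg hnn]
    · rw [Q0, hw1, show -1 * w.2 * c^2 * w.2 = -(w.2^2*c^2) by ring, abs_neg, abs_of_nonneg hnn]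
  have hint := mm_int w.2 c hb hc
  have hsplit : (∫ s in Set.Ioc 0 t₁, mmf w.2 c s) + ∫ s in Set.Ioc t₁ t₂, mmf w.2 c s
      = ∫ s in Set.Ioc 0 t₂, mmf w.2 c s := by
    rw [← Set.Ioc_union_Ioc_eq_Ioc ht₁.le ht₁₂.le,
      setIntegral_union (Set.Ioc_disjoint_Ioc_of_le le_rfl) measurableSet_Ioc
      (hint.mono_set Set.Ioc_subset_Ioi_self)
      (hint.mono_set (Set.Ioc_subset_Ioi_self.trans (Set.Ioi_subset_Ioi ht₁.le)))]
  rw [hQ, mm_beta w c e he hb hc hw1 t₁ ht₁, mm_beta w c e he hb hc hw1 t₂ ht₂,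
    mm_a w c e he hb hc hw1 t₁ t₂ ht₁ ht₂, intervalIntegral.integral_of_le ht₁₂.le,
    ← integral_const_mul,
    setIntegral_congr_fun (g := mmf w.2 c) measurableSet_Ioc
      (fun s hs => mm_eq w c e he hw1 s (ht₁.trans hs.1).ne')]
  have key : 1 - Real.sign ((t₁ - c) * (t₂ - c)) = Real.sign (t₂ - c) - Real.sign (t₁ - c) := by
    rcases lt_trichotomy t₁ c with h | h | h
    · have h1 : t₁ - c < 0 := by linarith
      rw [Real.sign_of_neg h1]
      rcases lt_trichotomy t₂ c with h' | h' | h'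
      · have h2 : t₂ - c < 0 := by linarith
        rw [Real.sign_of_neg h2, Real.sign_of_pos (mul_pos_of_neg_of_neg h1 h2)]; norm_num
      · simp [h']
      · have h2 : 0 < t₂ - c := by linarith
        rw [Real.sign_of_pos h2, Real.sign_of_neg (mul_neg_of_neg_of_pos h1 h2)]
    · have h2 : 0 < t₂ - c := by linarith
      rw [Real.sign_of_pos h2]; simp [h]
    · have h1 : 0 < t₁ - c := by linarith
      have h2 : 0 < t₂ - c := by linarith
      rw [Real.sign_of_pos h2, Real.sign_of_pos h1, Real.sign_of_pos (mul_pos h1 h2)]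
  rw [key]
  linear_combination hsplit
end

section
/- Let t₀ > 0 and λ = (λ₁,λ₂) ∈ ℝ² with λ_{t₀}^+ ≠ 0 and λ_{t₀}^− ≠ 0. Then the function h(v) := β_{t₀}(√v·λ) on v > 0 (where √v·λ = (√v·λ₁, √v·λ₂)) satisfies v·h''(v) + h'(v) − 4π²·Q₀(λ)²·v·h(v) = 2π·λ_{t₀}^+·λ_{t₀}^−·exp(−2πv((λ_{t₀}^+)² + (λ_{t₀}^−)²)) for all v > 0. -/
open Real MeasureTheory

theorem ode_aux_int (μ : Measure ℝ) (g w : ℝ → ℝ) (hgm : Measurable g) (hwm : Measurable w)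
    (hg : ∀ᵐ t ∂μ, 0 ≤ g t) (hw : ∀ᵐ t ∂μ, 0 ≤ w t)
    (hI : ∀ v : ℝ, 0 < v → Integrable (fun t => Real.exp (-(v * g t)) * w t) μ)
    (k : ℕ) (v : ℝ) (hv : 0 < v) :
    Integrable (fun t => g t ^ k * (Real.exp (-(v * g t)) * w t)) μ := by
  refine Integrable.mono' ((hI (v/2) (by positivity)).const_mul (k.factorial * (2 / v) ^ k)) ?_ ?_
  · have : Measurable (fun t => g t ^ k * (Real.exp (-(v * g t)) * w t)) := by fun_prop
    exact this.aestronglyMeasurable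
  · filter_upwards [hg, hw] with t h1 h2
    rw [Real.norm_of_nonneg (by positivity)]
    have h3 := Real.pow_div_factorial_le_exp (v / 2 * g t) (by positivity) k
    have h4 : g t ^ k ≤ k.factorial * (2 / v) ^ k * Real.exp (v / 2 * g t) := by
      have : g t ^ k = k.factorial * (2 / v) ^ k * ((v / 2 * g t) ^ k / k.factorial) := by
        rw [mul_pow, div_pow, div_pow]
        have : (k.factorial : ℝ) ≠ 0 := by positivity
        field_simp
      rw [this]
      gcongr
    calc g t ^ k * (Real.exp (-(v * g t)) * w t)
        ≤ (k.factorial * (2 / v) ^ k * Real.exp (v / 2 * g t)) * (Real.exp (-(v * g t)) * w t) := by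
          gcongr
      _ = k.factorial * (2 / v) ^ k * ((Real.exp (v / 2 * g t) * Real.exp (-(v * g t))) * w t) := by
          ring
      _ = _ := by
          rw [← Real.exp_add]
          congr 4
          ring

theorem ode_aux_deriv (μ : Measure ℝ) (g w : ℝ → ℝ) (hgm : Measurable g) (hwm : Measurable w)
    (hg : ∀ᵐ t ∂μ, 0 ≤ g t) (hw : ∀ᵐ t ∂μ, 0 ≤ w t)
    (hI : ∀ v : ℝ, 0 < v → Integrable (fun t => Real.exp (-(v * g t)) * w t) μ)
    (k : ℕ) (v : ℝ) (hv : 0 < v) :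
    HasDerivAt (fun x => ∫ t, g t ^ k * (Real.exp (-(x * g t)) * w t) ∂μ)
      (-∫ t, g t ^ (k+1) * (Real.exp (-(v * g t)) * w t) ∂μ) v := by
  rw [← integral_neg]
  refine (hasDerivAt_integral_of_dominated_loc_of_deriv_le
    (F := fun x t => g t ^ k * (Real.exp (-(x * g t)) * w t))
    (F' := fun x t => -(g t ^ (k+1) * (Real.exp (-(x * g t)) * w t)))
    (bound := fun t => g t ^ (k+1) * (Real.exp (-(v/2 * g t)) * w t))
    (Ioi_mem_nhds (show v/2 < v by linarith)) ?_ ?_ ?_ ?_ ?_ ?_).2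
  · refine Filter.Eventually.of_forall fun x => ?_
    have : Measurable (fun t => g t ^ k * (Real.exp (-(x * g t)) * w t)) := by fun_prop
    exact this.aestronglyMeasurable
  · exact ode_aux_int μ g w hgm hwm hg hw hI k v hv
  · have : Measurable (fun t => -(g t ^ (k+1) * (Real.exp (-(v * g t)) * w t))) := by fun_prop
    exact this.aestronglyMeasurable
  · filter_upwards [hg, hw] with t h1 h2 x hx
    rw [norm_neg, Real.norm_of_nonneg (by positivity)]
    have : v / 2 ≤ x := le_of_lt hx
    gcongr
  · exact ode_aux_int μ g w hgm hwm hg hw hI (k+1) (v/2) (by positivity)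
  · filter_upwards with t x hx
    have h1 : HasDerivAt (fun x : ℝ => -(x * g t)) (-(1 * g t)) x :=
      ((hasDerivAt_id x).mul_const (g t)).neg
    refine ((h1.exp.mul_const (w t)).const_mul (g t ^ k)).congr_deriv ?_
    ring

theorem ode_aux_main (μ : Measure ℝ) (g w : ℝ → ℝ) (hgm : Measurable g) (hwm : Measurable w)
    (hg : ∀ᵐ t ∂μ, 0 ≤ g t) (hw : ∀ᵐ t ∂μ, 0 ≤ w t)
    (hI : ∀ v : ℝ, 0 < v → Integrable (fun t => Real.exp (-(v * g t)) * w t) μ)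
    (h : ℝ → ℝ) (s c : ℝ)
    (hh : ∀ v : ℝ, 0 < v → h v = s * ∫ t, Real.exp (-(v * g t)) * w t ∂μ)
    (v : ℝ) (hv : 0 < v) :
    v * deriv (deriv h) v + deriv h v - c * v * h v
      = s * ∫ t, (v * g t ^ 2 - g t - c * v) * (Real.exp (-(v * g t)) * w t) ∂μ := by
  have hint := ode_aux_int μ g w hgm hwm hg hw hI
  have hder := ode_aux_deriv μ g w hgm hwm hg hw hI
  have d1 : ∀ x : ℝ, 0 < x → deriv h x
      = -s * ∫ t, g t ^ 1 * (Real.exp (-(x * g t)) * w t) ∂μ := by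
    intro x hx
    have e : h =ᶠ[nhds x] fun x => s * ∫ t, g t ^ 0 * (Real.exp (-(x * g t)) * w t) ∂μ := by
      filter_upwards [Ioi_mem_nhds hx] with y hy
      rw [hh y hy]; simp
    rw [e.deriv_eq, ((hder 0 x hx).const_mul s).deriv]
    ring
  have d2 : deriv (deriv h) v = s * ∫ t, g t ^ 2 * (Real.exp (-(v * g t)) * w t) ∂μ := by
    have e : deriv h =ᶠ[nhds v]
        fun x => -s * ∫ t, g t ^ 1 * (Real.exp (-(x * g t)) * w t) ∂μ := by
      filter_upwards [Ioi_mem_nhds hv] with y hy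
      exact d1 y hy
    rw [e.deriv_eq, ((hder 1 v hv).const_mul (-s)).deriv]
    ring
  rw [d2, d1 v hv, hh v hv]
  have i2 := (hint 2 v hv).const_mul v
  have i1 := hint 1 v hv
  have i0 := (hI v hv).const_mul (c * v)
  have : (fun t => (v * g t ^ 2 - g t - c * v) * (Real.exp (-(v * g t)) * w t))
    = fun t => v * (g t ^ 2 * (Real.exp (-(v * g t)) * w t))
      - g t ^ 1 * (Real.exp (-(v * g t)) * w t) - c * v * (Real.exp (-(v * g t)) * w t) := by
    funext t; ring
  have i21 : Integrable (fun t => v * (g t ^ 2 * (Real.exp (-(v * g t)) * w t))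
      - g t ^ 1 * (Real.exp (-(v * g t)) * w t)) μ := i2.sub i1
  rw [this, integral_sub i21 i0, integral_sub i2 i1, integral_const_mul,
    integral_const_mul]
  ring

/-- The exponent. -/
noncomputable def odeG (a b t : ℝ) : ℝ := π * (a ^ 2 / t ^ 2 + b ^ 2 * t ^ 2)

/-- The primitive. -/
noncomputable def odeP (a b v t : ℝ) : ℝ :=
  -(π / 2 * (b ^ 2 * t ^ 2 - a ^ 2 / t ^ 2)) * Real.exp (-(v * odeG a b t))

theorem odeG_nonneg (a b t : ℝ) : 0 ≤ odeG a b t := by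
  unfold odeG; positivity

theorem odeG_meas (a b : ℝ) : Measurable (odeG a b) := by
  unfold odeG; fun_prop

theorem odeP_deriv (a b v t : ℝ) (ht : t ≠ 0) : HasDerivAt (odeP a b v)
    ((v * odeG a b t ^ 2 - odeG a b t - 4 * π ^ 2 * (a * b) ^ 2 * v)
      * (Real.exp (-(v * odeG a b t)) * t⁻¹)) t := by
  have hs : HasDerivAt (fun t : ℝ => t ^ 2) (2 * t) t := by
    simpa using hasDerivAt_pow 2 t
  have hi : HasDerivAt (fun t : ℝ => a ^ 2 / t ^ 2) ((0 * t ^ 2 - a ^ 2 * (2 * t)) / (t ^ 2) ^ 2) t :=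
    (hasDerivAt_const t (a ^ 2)).div hs (by positivity)
  have hG : HasDerivAt (odeG a b) _ t := (hi.add (hs.const_mul (b ^ 2))).const_mul π
  have hK := (((hs.const_mul (b ^ 2)).sub hi).const_mul (π / 2)).neg
  refine (hK.mul (hG.const_mul v).neg.exp).congr_deriv ?_
  simp only [odeG, Pi.neg_apply, Pi.sub_apply, Pi.mul_apply]
  field_simp
  ring

theorem odeP_tendsto (a b v : ℝ) (hv : 0 < v) (l : Filter ℝ)
    (hl : Filter.Tendsto (odeG a b) l Filter.atTop) :
    Filter.Tendsto (odeP a b v) l (nhds 0) := by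
  have h1 : Filter.Tendsto (fun t => v * odeG a b t) l Filter.atTop :=
    hl.const_mul_atTop hv
  have h2 := (Real.tendsto_pow_mul_exp_neg_atTop_nhds_zero 1).comp h1
  have h3 := h2.const_mul v⁻¹
  rw [mul_zero] at h3
  refine squeeze_zero_norm (fun t => ?_) h3
  simp only [odeP, Function.comp, norm_mul, Real.norm_eq_abs, Real.abs_exp, pow_one]
  rw [← mul_assoc, ← mul_assoc, inv_mul_cancel₀ hv.ne', one_mul]
  gcongr
  rw [abs_neg, abs_le]
  unfold odeG
  have := pi_pos
  have h5 : 0 ≤ a ^ 2 / t ^ 2 := by positivity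
  have h6 : 0 ≤ b ^ 2 * t ^ 2 := by positivity
  constructor <;> nlinarith [mul_nonneg this.le h5, mul_nonneg this.le h6]

theorem odeG_top (a b : ℝ) (hb : b ≠ 0) :
    Filter.Tendsto (odeG a b) Filter.atTop Filter.atTop := by
  have h : Filter.Tendsto (fun t : ℝ => (π * b ^ 2) * t ^ 2) Filter.atTop Filter.atTop :=
    (Filter.tendsto_pow_atTop (by norm_num)).const_mul_atTop (by positivity)
  refine Filter.tendsto_atTop_mono (fun t => ?_) h
  have : 0 ≤ π * (a ^ 2 / t ^ 2) := by positivity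
  unfold odeG; linarith

theorem odeG_zero (a b : ℝ) (ha : a ≠ 0) :
    Filter.Tendsto (odeG a b) (nhdsWithin 0 (Set.Ioi 0)) Filter.atTop := by
  have h := (odeG_top b a ha).comp (tendsto_inv_nhdsGT_zero (𝕜 := ℝ))
  refine h.congr fun t => ?_
  simp only [odeG, Function.comp, inv_pow, div_inv_eq_mul]
  ring

theorem ode_int_top (a b t₀ : ℝ) (ht : 0 < t₀) (hb : b ≠ 0) (v : ℝ) (hv : 0 < v) :
    Integrable (fun t => Real.exp (-(v * odeG a b t)) * t⁻¹) (volume.restrict (Set.Ioi t₀)) := by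
  have hgm := odeG_meas a b
  refine Integrable.mono' (((integrable_exp_neg_mul_sq (b := v * π * b ^ 2)
    (by positivity)).mul_const t₀⁻¹).integrableOn) ?_ ?_
  · have : Measurable (fun t => Real.exp (-(v * odeG a b t)) * t⁻¹) := by fun_prop
    exact this.aestronglyMeasurable
  · filter_upwards [ae_restrict_mem measurableSet_Ioi] with t h
    have h : t₀ < t := h
    have h0 : 0 < t := ht.trans h
    rw [Real.norm_of_nonneg (by positivity)]
    gcongr
    have : 0 ≤ v * π * (a ^ 2 / t ^ 2) := by positivity
    unfold odeG; nlinarith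

theorem ode_int_zero (a b t₀ : ℝ) (ht : 0 < t₀) (ha : a ≠ 0) (v : ℝ) (hv : 0 < v) :
    Integrable (fun t => Real.exp (-(v * odeG a b t)) * t⁻¹)
      (volume.restrict (Set.Ioc 0 t₀)) := by
  have hgm := odeG_meas a b
  refine Integrable.mono' (g := fun _ => (v * π * a ^ 2)⁻¹ * t₀) (integrable_const _) ?_ ?_
  · have : Measurable (fun t => Real.exp (-(v * odeG a b t)) * t⁻¹) := by fun_prop
    exact this.aestronglyMeasurable
  · filter_upwards [ae_restrict_mem measurableSet_Ioc] with t h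
    obtain ⟨h0, h1⟩ := h
    rw [Real.norm_of_nonneg (by positivity)]
    have h2 : v * π * a ^ 2 / t ^ 2 ≤ Real.exp (v * odeG a b t) := by
      refine le_trans ?_ ((le_add_of_nonneg_right zero_le_one).trans
        (Real.add_one_le_exp (v * odeG a b t)))
      have : 0 ≤ v * π * (b ^ 2 * t ^ 2) := by positivity
      have e : v * π * a ^ 2 / t ^ 2 = v * π * (a ^ 2 / t ^ 2) := by ring
      rw [e]
      unfold odeG; nlinarith
    rw [Real.exp_neg]
    calc (Real.exp (v * odeG a b t))⁻¹ * t⁻¹ ≤ (v * π * a ^ 2 / t ^ 2)⁻¹ * t⁻¹ := by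
          gcongr
      _ = (v * π * a ^ 2)⁻¹ * t := by field_simp
      _ ≤ _ := by gcongr

theorem ode_lhs_int (a b v : ℝ) (hv : 0 < v) (μ : Measure ℝ) (hw : ∀ᵐ t ∂μ, 0 ≤ t⁻¹)
    (hI : ∀ v : ℝ, 0 < v → Integrable (fun t => Real.exp (-(v * odeG a b t)) * t⁻¹) μ) (c : ℝ) :
    Integrable (fun t => (v * odeG a b t ^ 2 - odeG a b t - c * v)
      * (Real.exp (-(v * odeG a b t)) * t⁻¹)) μ := by
  have hint := ode_aux_int μ (odeG a b) (fun t => t⁻¹) (odeG_meas a b) measurable_inv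
    (Filter.Eventually.of_forall (odeG_nonneg a b)) hw hI
  have := (((hint 2 v hv).const_mul v).sub (hint 1 v hv)).sub ((hI v hv).const_mul (c * v))
  refine this.congr (Filter.Eventually.of_forall fun t => ?_)
  simp only [Pi.sub_apply]
  ring

theorem ode_exponent (lam : ℝ × ℝ) (x t : ℝ) (hx : 0 < x) (ht : t ≠ 0) :
    Real.exp (-(2 * π * Q0 (Real.sqrt x * lam.1, Real.sqrt x * lam.2))) *
      (Real.exp (-(4 * π * (lamM (Real.sqrt x * lam.1, Real.sqrt x * lam.2) t)^2)) / t)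
     = Real.exp (-(x * odeG lam.1 lam.2 t)) * t⁻¹ := by
  rw [div_eq_mul_inv, ← mul_assoc, ← Real.exp_add]
  congr 2
  obtain ⟨r, hr, rfl⟩ : ∃ r : ℝ, 0 < r ∧ x = r ^ 2 :=
    ⟨Real.sqrt x, Real.sqrt_pos.2 hx, (Real.sq_sqrt hx.le).symm⟩
  rw [Real.sqrt_sq hr.le]
  simp only [Q0, lamM, odeG]
  field_simp
  ring

theorem ode_sign (lam : ℝ × ℝ) (x t : ℝ) (hx : 0 < x) :
    lamM (Real.sqrt x * lam.1, Real.sqrt x * lam.2) t *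
      lamP (Real.sqrt x * lam.1, Real.sqrt x * lam.2) t = x * (lamM lam t * lamP lam t) := by
  obtain ⟨r, hr, rfl⟩ : ∃ r : ℝ, 0 < r ∧ x = r ^ 2 :=
    ⟨Real.sqrt x, Real.sqrt_pos.2 hx, (Real.sq_sqrt hx.le).symm⟩
  rw [Real.sqrt_sq hr.le]
  simp only [lamP, lamM]
  ring

theorem ode_rhs (lam : ℝ × ℝ) (v t : ℝ) (ht : 0 < t) :
    2 * π * lamP lam t * lamM lam t *
          Real.exp (-(2 * π * v * ((lamP lam t)^2 + (lamM lam t)^2)))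
      = - odeP lam.1 lam.2 v t := by
  unfold odeP
  rw [neg_mul, neg_neg]
  congr 1
  · simp only [lamP, lamM]; field_simp; ring
  · congr 1; simp only [lamP, lamM, odeG]; field_simp; ring

/-- The inhomogeneous ODE satisfied by `h(v) = β_{t₀}(√v·λ)`:
`v h'' + h' − 4π²Q₀(λ)² v h = 2π λ_{t₀}⁺ λ_{t₀}⁻ e^{−2πv((λ_{t₀}⁺)² + (λ_{t₀}⁻)²)}`. -/
theorem betaF_inhomogeneous_ode (t₀ : ℝ) (ht₀ : 0 < t₀) (lam : ℝ × ℝ)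
    (hp : lamP lam t₀ ≠ 0) (hm : lamM lam t₀ ≠ 0) (v : ℝ) (hv : 0 < v) :
    v * deriv (deriv (fun v' : ℝ =>
        betaF t₀ (Real.sqrt v' * lam.1, Real.sqrt v' * lam.2))) v
      + deriv (fun v' : ℝ => betaF t₀ (Real.sqrt v' * lam.1, Real.sqrt v' * lam.2)) v
      - 4 * π^2 * (Q0 lam)^2 * v * betaF t₀ (Real.sqrt v * lam.1, Real.sqrt v * lam.2)
      = 2 * π * lamP lam t₀ * lamM lam t₀ *
          Real.exp (-(2 * π * v * ((lamP lam t₀)^2 + (lamM lam t₀)^2))) := by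
  have hQ : 4 * π ^ 2 * (Q0 lam) ^ 2 = 4 * π ^ 2 * (lam.1 * lam.2) ^ 2 := rfl
  rw [hQ, ode_rhs lam v t₀ ht₀]
  have hprod : lamM lam t₀ * lamP lam t₀
      = (lam.2 ^ 2 * t₀ ^ 2 - lam.1 ^ 2 / t₀ ^ 2) / 4 := by
    simp only [lamP, lamM]; field_simp; ring
  rcases lt_or_gt_of_ne (mul_ne_zero hm hp) with hs | hs
  · have ha : lam.1 ≠ 0 := by
      intro h0
      rw [hprod, h0] at hs
      have : 0 ≤ lam.2 ^ 2 * t₀ ^ 2 := by positivity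
      norm_num at hs
      linarith
    have hw : ∀ᵐ t ∂(volume.restrict (Set.Ioc 0 t₀)), 0 ≤ (t : ℝ)⁻¹ := by
      filter_upwards [ae_restrict_mem measurableSet_Ioc] with t h
      exact (inv_pos.2 h.1).le
    have hI := ode_int_zero lam.1 lam.2 t₀ ht₀ ha
    have key := ode_aux_main (volume.restrict (Set.Ioc 0 t₀)) (odeG lam.1 lam.2) (fun t => t⁻¹)
      (odeG_meas _ _) measurable_inv (Filter.Eventually.of_forall (odeG_nonneg _ _)) hw hI
      (fun v' : ℝ => betaF t₀ (Real.sqrt v' * lam.1, Real.sqrt v' * lam.2)) (-1)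
      (4 * π ^ 2 * (lam.1 * lam.2) ^ 2) ?_ v hv
    · rw [key, ← intervalIntegral.integral_of_le ht₀.le]
      have hli := ode_lhs_int lam.1 lam.2 v hv _ hw hI (4 * π ^ 2 * (lam.1 * lam.2) ^ 2)
      rw [intervalIntegral.integral_eq_sub_of_hasDerivAt_of_tendsto ht₀
        (fun t ht => odeP_deriv lam.1 lam.2 v t ht.1.ne')
        ((intervalIntegrable_iff_integrableOn_Ioc_of_le ht₀.le).2 hli)
        (odeP_tendsto _ _ v hv _ (odeG_zero _ _ ha))
        ((odeP_deriv lam.1 lam.2 v t₀ ht₀.ne').continuousAt.tendsto.mono_left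
          nhdsWithin_le_nhds)]
      ring
    · intro x hx
      have h1 : x * (lamM lam t₀ * lamP lam t₀) < 0 := mul_neg_of_pos_of_neg hx hs
      simp only [betaF, ode_sign lam x t₀ hx]
      rw [if_neg h1.not_gt, if_pos h1, ← integral_const_mul, neg_one_mul]
      congr 1
      refine setIntegral_congr_fun measurableSet_Ioc fun t ht => ?_
      exact ode_exponent lam x t hx ht.1.ne'
  · have hb : lam.2 ≠ 0 := by
      intro h0
      rw [hprod, h0] at hs
      have : 0 ≤ lam.1 ^ 2 / t₀ ^ 2 := by positivity
      norm_num at hs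
      linarith
    have hw : ∀ᵐ t ∂(volume.restrict (Set.Ioi t₀)), 0 ≤ (t : ℝ)⁻¹ := by
      filter_upwards [ae_restrict_mem measurableSet_Ioi] with t h
      exact (inv_pos.2 (ht₀.trans h)).le
    have hI := ode_int_top lam.1 lam.2 t₀ ht₀ hb
    have key := ode_aux_main (volume.restrict (Set.Ioi t₀)) (odeG lam.1 lam.2) (fun t => t⁻¹)
      (odeG_meas _ _) measurable_inv (Filter.Eventually.of_forall (odeG_nonneg _ _)) hw hI
      (fun v' : ℝ => betaF t₀ (Real.sqrt v' * lam.1, Real.sqrt v' * lam.2)) 1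
      (4 * π ^ 2 * (lam.1 * lam.2) ^ 2) ?_ v hv
    · rw [key]
      have hli := ode_lhs_int lam.1 lam.2 v hv _ hw hI (4 * π ^ 2 * (lam.1 * lam.2) ^ 2)
      rw [integral_Ioi_of_hasDerivAt_of_tendsto'
        (fun t ht => odeP_deriv lam.1 lam.2 v t (ht₀.trans_le ht).ne') hli
        (odeP_tendsto _ _ v hv _ (odeG_top _ _ hb))]
      ring
    · intro x hx
      have h1 : 0 < x * (lamM lam t₀ * lamP lam t₀) := mul_pos hx hs
      simp only [betaF, ode_sign lam x t₀ hx]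
      rw [if_pos h1, ← integral_const_mul, one_mul]
      refine setIntegral_congr_fun measurableSet_Ioi fun t ht => ?_
      exact ode_exponent lam x t hx (ht₀.trans ht).ne'
end

section
/- Let ε > 1, t₀ > 0, v > 0, and λ = (λ₁,λ₂) ∈ ℝ² with λ₁λ₂ ≠ 0, and set λₙ := (ε^n·λ₁, ε^{−n}·λ₂) for n ∈ ℤ. Then the families (β̃_{t₀}(√v·λₙ))_{n∈ℤ} and (β_{t₀}(√v·λₙ))_{n∈ℤ} are summable, and ∑_{n∈ℤ} β̃_{t₀}(√v·λₙ) = −log(ε)·∑_{n∈ℤ} β_{t₀}(√v·λₙ) + c̃_{t₀}(λ)·K₀(2π·|λ₁λ₂|·v). -/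
open Real MeasureTheory

/-- The function `β̃_{t₀}(w)` depending on a unit `ε`. -/
noncomputable def betaTilde (ε t₀ : ℝ) (w : ℝ × ℝ) : ℝ :=
  Real.exp (-(2 * π * Q0 w)) *
    ∫ t in t₀..(t₀ * ε), Real.exp (-(4 * π * (lamM w t)^2)) * Real.log t / t

/-- The first periodic Bernoulli polynomial `𝔹₁ : ℝ/ℤ → ℝ`. -/
noncomputable def B1 (x : ℝ) : ℝ := if Int.fract x = 0 then 0 else Int.fract x - 1/2

/-- The coefficient `c̃_{t₀}(λ)` for `Q₀(λ) ≠ 0`. -/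
noncomputable def cTilde (ε t₀ : ℝ) (w : ℝ × ℝ) : ℝ :=
  Real.log (t₀^2 * ε) / 2 +
    Real.log ε * B1 (Real.log (|w.1 / w.2| / t₀^2) / (2 * Real.log ε))

/-- The even kernel. -/
noncomputable def fk (x u : ℝ) : ℝ := Real.exp (-x * Real.cosh (2 * u))

lemma fk_cont (x : ℝ) : Continuous (fk x) := by unfold fk; fun_prop

lemma fk_neg (x u : ℝ) : fk x (-u) = fk x u := by
  unfold fk; rw [mul_neg, Real.cosh_neg]

lemma fk_pos (x u : ℝ) : 0 < fk x u := Real.exp_pos _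

lemma le_cosh (u : ℝ) (_hu : 0 ≤ u) : u ≤ Real.cosh (2 * u) := by
  have h1 := Real.add_one_le_exp (2 * u)
  have h2 := Real.exp_pos (-(2 * u))
  rw [Real.cosh_eq]; linarith

lemma fk_le (x u : ℝ) (hx : 0 < x) (hu : 0 ≤ u) : fk x u ≤ Real.exp (-x * u) := by
  unfold fk
  apply Real.exp_le_exp.2
  nlinarith [le_cosh u hu]

lemma ufk_le (x u : ℝ) (hx : 0 < x) (hu : 0 ≤ u) :
    u * fk x u ≤ (2 / x) * Real.exp (-(x / 2) * u) := by
  have h1 : u ≤ (2 / x) * Real.exp ((x / 2) * u) := by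
    have := Real.add_one_le_exp ((x / 2) * u)
    have h3 : x / 2 * u ≤ Real.exp ((x / 2) * u) := by linarith
    rw [div_mul_eq_mul_div, le_div_iff₀ hx]; linarith
  calc u * fk x u ≤ ((2 / x) * Real.exp ((x / 2) * u)) * Real.exp (-x * u) :=
        mul_le_mul h1 (fk_le x u hx hu) (fk_pos x u).le (by positivity)
    _ = _ := by rw [mul_assoc, ← Real.exp_add]; ring_nf

lemma fk_int (x y : ℝ) (hx : 0 < x) (hy : 0 ≤ y) : IntegrableOn (fk x) (Set.Ioi y) := by
  refine Integrable.mono' (exp_neg_integrableOn_Ioi y hx) (fk_cont x).aestronglyMeasurable ?_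
  filter_upwards [ae_restrict_mem measurableSet_Ioi] with u hu
  rw [Real.norm_of_nonneg (fk_pos x u).le]
  exact fk_le x u hx (hy.trans (le_of_lt hu))

lemma ufk_int (x y : ℝ) (hx : 0 < x) (hy : 0 ≤ y) :
    IntegrableOn (fun u => u * fk x u) (Set.Ioi y) := by
  refine Integrable.mono' ((exp_neg_integrableOn_Ioi y (half_pos hx)).const_mul (2 / x))
    (continuous_id.mul (fk_cont x)).aestronglyMeasurable ?_
  filter_upwards [ae_restrict_mem measurableSet_Ioi] with u hu
  have hu0 : 0 ≤ u := hy.trans (le_of_lt hu)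
  rw [Real.norm_of_nonneg (mul_nonneg hu0 (fk_pos x u).le)]
  exact ufk_le x u hx hu0

/-- Tail integral. -/
noncomputable def Ff (x y : ℝ) : ℝ := ∫ u in Set.Ioi y, fk x u

/-- Tail of the first moment. -/
noncomputable def Ef (x y : ℝ) : ℝ := ∫ u in Set.Ioi y, u * fk x u

lemma Ff_nonneg (x y : ℝ) : 0 ≤ Ff x y :=
  setIntegral_nonneg measurableSet_Ioi (fun u _ => (fk_pos x u).le)

lemma Ef_nonneg (x y : ℝ) (hy : 0 ≤ y) : 0 ≤ Ef x y :=
  setIntegral_nonneg measurableSet_Ioi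
    (fun u hu => mul_nonneg (hy.trans (le_of_lt hu)) (fk_pos x u).le)

lemma Ff_le (x y : ℝ) (hx : 0 < x) (hy : 0 ≤ y) : Ff x y ≤ (1 / x) * Real.exp (-x * y) := by
  have h := setIntegral_mono_on (fk_int x y hx hy) (exp_neg_integrableOn_Ioi y hx)
    measurableSet_Ioi (fun u hu => fk_le x u hx (hy.trans (le_of_lt hu)))
  rw [integral_exp_mul_Ioi (by linarith)] at h
  refine h.trans (le_of_eq ?_)
  field_simp

lemma Ef_le (x y : ℝ) (hx : 0 < x) (hy : 0 ≤ y) :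
    Ef x y ≤ (4 / x ^ 2) * Real.exp (-(x / 2) * y) := by
  have h := setIntegral_mono_on (ufk_int x y hx hy)
    ((exp_neg_integrableOn_Ioi y (half_pos hx)).const_mul (2 / x))
    measurableSet_Ioi (fun u hu => ufk_le x u hx (hy.trans (le_of_lt hu)))
  rw [integral_const_mul, integral_exp_mul_Ioi (by linarith)] at h
  refine h.trans (le_of_eq ?_)
  field_simp
  norm_num

lemma K0_eq (x : ℝ) : K0 x = 2 * Ff x 0 := by
  unfold K0 Ff fk
  have := integral_comp_mul_left_Ioi (fun T => Real.exp (-x * Real.cosh T)) 0 (b := 2) (by norm_num)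
  simp only [mul_zero, smul_eq_mul] at this
  rw [this]; ring

/-- The reduced beta function. -/
noncomputable def bet (x u : ℝ) : ℝ := Real.sign u * Ff x |u|

lemma int_fk (x u : ℝ) (hx : 0 < x) : ∫ s in (0:ℝ)..u, fk x s = Real.sign u * Ff x 0 - bet x u := by
  have key : ∀ u : ℝ, 0 ≤ u → ∫ s in (0:ℝ)..u, fk x s = Ff x 0 - Ff x u := fun u hu =>
    (intervalIntegral.integral_Ioi_sub_Ioi (fk_int x 0 hx le_rfl) hu).symm
  unfold bet
  rcases lt_trichotomy u 0 with h | h | h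
  · rw [Real.sign_of_neg h, abs_of_neg h]
    have h1 := key (-u) (by linarith)
    have h2 := intervalIntegral.integral_comp_neg (a := 0) (b := u) (fk x)
    simp only [fk_neg, neg_zero] at h2
    rw [h2, intervalIntegral.integral_symm, h1]; ring
  · subst h; simp
  · rw [Real.sign_of_pos h, abs_of_pos h, key u h.le]; ring

lemma int_ufk (x u : ℝ) (hx : 0 < x) : ∫ s in (0:ℝ)..u, s * fk x s = Ef x 0 - Ef x |u| := by
  have key : ∀ u : ℝ, 0 ≤ u → ∫ s in (0:ℝ)..u, s * fk x s = Ef x 0 - Ef x u := fun u hu =>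
    (intervalIntegral.integral_Ioi_sub_Ioi (ufk_int x 0 hx le_rfl) hu).symm
  rcases le_total 0 u with h | h
  · rw [abs_of_nonneg h, key u h]
  · rw [abs_of_nonpos h]
    have h1 := key (-u) (by linarith)
    have h2 := intervalIntegral.integral_comp_neg (a := 0) (b := u) (fun s => s * fk x s)
    simp only [fk_neg, neg_zero, neg_mul, intervalIntegral.integral_neg] at h2
    have h3 := intervalIntegral.integral_symm (μ := volume) (f := fun s => s * fk x s) 0 u
    have h4 := intervalIntegral.integral_symm (μ := volume) (f := fun s => s * fk x s) 0 (-u)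
    linarith

/-- telescoping potential -/
noncomputable def Pf (x s u : ℝ) : ℝ := -Ef x |u| + u * bet x u - s * bet x u

lemma tilde_id (x s u L : ℝ) (hx : 0 < x) :
    ∫ r in u..(u + L), fk x r * (r - u + s) =
      Pf x s (u + L) - Pf x s u - L * bet x (u + L)
        - Ff x 0 * ((u - s) * (Real.sign (u + L) - Real.sign u)) := by
  have c1 : Continuous (fun r => r * fk x r) := continuous_id.mul (fk_cont x)
  have e : ∀ r, fk x r * (r - u + s) = r * fk x r - (u - s) * fk x r := fun r => by ring
  simp only [e]
  rw [intervalIntegral.integral_sub (c1.intervalIntegrable _ _)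
    (((fk_cont x).const_mul _).intervalIntegrable _ _), intervalIntegral.integral_const_mul,
    ← intervalIntegral.integral_interval_sub_left (c1.intervalIntegrable 0 _)
      (c1.intervalIntegrable 0 _),
    ← intervalIntegral.integral_interval_sub_left ((fk_cont x).intervalIntegrable 0 _)
      ((fk_cont x).intervalIntegrable 0 _), int_fk x _ hx, int_fk x _ hx, int_ufk x _ hx,
      int_ufk x _ hx]
  unfold Pf
  ring

lemma abs_sign_le (u : ℝ) : |Real.sign u| ≤ 1 := by
  rcases lt_trichotomy u 0 with h | h | h
  · simp [Real.sign_of_neg h]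
  · simp [h]
  · simp [Real.sign_of_pos h]

lemma bet_le (x u : ℝ) (hx : 0 < x) : |bet x u| ≤ (1 / x) * Real.exp (-x * |u|) := by
  unfold bet
  rw [abs_mul, abs_of_nonneg (Ff_nonneg x |u|)]
  calc _ ≤ 1 * Ff x |u| := mul_le_mul_of_nonneg_right (abs_sign_le u) (Ff_nonneg x |u|)
    _ ≤ _ := by rw [one_mul]; exact Ff_le x _ hx (abs_nonneg u)

lemma summ_exp (c a L : ℝ) (hc : 0 < c) (hL : 0 < L) :
    Summable (fun n : ℤ => Real.exp (-c * |a - n * L|)) := by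
  have h0 : Summable (fun n : ℕ => Real.exp (c * |a|) * Real.exp (-(c * L)) ^ n) := by
    apply Summable.mul_left
    apply summable_geometric_of_lt_one (Real.exp_pos _).le
    rw [Real.exp_lt_one_iff]; have := mul_pos hc hL; linarith
  have key : ∀ n : ℕ, ∀ m : ℤ, |(m:ℝ)| = n → Real.exp (-c * |a - m * L|) ≤
      Real.exp (c * |a|) * Real.exp (-(c * L)) ^ n := by
    intro n m hm
    rw [← Real.exp_nat_mul, ← Real.exp_add]
    apply Real.exp_le_exp.2
    have h1 : |(m:ℝ) * L| ≤ |a| + |a - m * L| := by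
      have := abs_sub a (a - m * L)
      simpa using this
    rw [abs_mul, hm, abs_of_pos hL] at h1
    nlinarith
  apply Summable.of_nat_of_neg
  · exact Summable.of_nonneg_of_le (fun n => (Real.exp_pos _).le) (fun n => key n n (by simp)) h0
  · exact Summable.of_nonneg_of_le (fun n => (Real.exp_pos _).le) (fun n => key n (-n) (by simp)) h0

lemma summ_bet (x a L : ℝ) (hx : 0 < x) (hL : 0 < L) :
    Summable (fun n : ℤ => bet x (a - n * L)) :=
  Summable.of_norm_bounded ((summ_exp x a L hx hL).mul_left (1 / x)) (fun n => bet_le x _ hx)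

lemma summ_ubet (x a L : ℝ) (hx : 0 < x) (hL : 0 < L) :
    Summable (fun n : ℤ => (a - n * L) * bet x (a - n * L)) := by
  refine Summable.of_norm_bounded
    ((summ_exp (x / 2) a L (half_pos hx) hL).mul_left (2 / x ^ 2)) (fun n => ?_)
  generalize a - n * L = u
  rw [Real.norm_eq_abs, abs_mul]
  have h1 : |u| ≤ (2 / x) * Real.exp ((x / 2) * |u|) := by
    have := Real.add_one_le_exp ((x / 2) * |u|)
    have h3 : x / 2 * |u| ≤ Real.exp ((x / 2) * |u|) := by linarith
    rw [div_mul_eq_mul_div, le_div_iff₀ hx]; linarith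
  calc |u| * |bet x u| ≤ ((2 / x) * Real.exp ((x / 2) * |u|)) * ((1 / x) * Real.exp (-x * |u|)) :=
        mul_le_mul h1 (bet_le x u hx) (abs_nonneg _) (by positivity)
    _ = (2 / x ^ 2) * (Real.exp ((x / 2) * |u|) * Real.exp (-x * |u|)) := by ring
    _ = _ := by rw [← Real.exp_add]; ring_nf

lemma summ_E (x a L : ℝ) (hx : 0 < x) (hL : 0 < L) :
    Summable (fun n : ℤ => Ef x |a - n * L|) :=
  Summable.of_nonneg_of_le (fun n => Ef_nonneg x _ (abs_nonneg _))
    (fun n => Ef_le x _ hx (abs_nonneg _))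
    ((summ_exp (x / 2) a L (half_pos hx) hL).mul_left (4 / x ^ 2))

lemma summ_P (x s a L : ℝ) (hx : 0 < x) (hL : 0 < L) :
    Summable (fun n : ℤ => Pf x s (a - n * L)) :=
  (((summ_E x a L hx hL).neg).add (summ_ubet x a L hx hL)).sub ((summ_bet x a L hx hL).mul_left s)

lemma hasSum_fin (s L y : ℝ) (hL : 0 < L) :
    HasSum (fun n : ℤ => ((-(y * L) - n * L) - s) *
      (Real.sign ((-(y * L) - n * L) + L) - Real.sign (-(y * L) - n * L)))
      (-2 * (s + L / 2 + L * B1 y)) := by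
  have sg : ∀ n : ℤ, Real.sign (-(y * L) - n * L) = -Real.sign (y + n) := by
    intro n
    have : -(y * L) - n * L = -((y + n) * L) := by ring
    rcases lt_trichotomy (y + n) 0 with h | h | h
    · rw [Real.sign_of_neg h, Real.sign_of_pos]; · norm_num
      rw [this]; nlinarith
    · rw [this, h]; simp
    · rw [Real.sign_of_pos h, Real.sign_of_neg]
      rw [this]; nlinarith
  have sg2 : ∀ n : ℤ, Real.sign (-(y * L) - n * L + L) = -Real.sign (y + n - 1) := by
    intro n
    have := sg (n - 1)
    push_cast at this
    rw [show -(y * L) - n * L + L = -(y * L) - (n - 1) * L by ring, this]; ring_nf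
  simp only [sg, sg2]
  have hy := Int.floor_add_fract y
  have hf0 := Int.fract_nonneg y
  have hf1 := Int.fract_lt_one y
  set k := ⌊y⌋
  set f := Int.fract y
  have hout : ∀ n : ℤ, n ≤ -k - 1 ∨ 2 - k ≤ n ∨ n = -k ∨ n = 1 - k := by intro n; omega
  have hz : ∀ n ∉ ({-k, 1 - k} : Finset ℤ), ((-(y * L) - n * L) - s) *
      (-Real.sign (y + n - 1) - -Real.sign (y + n)) = 0 := by
    intro n hn
    simp only [Finset.mem_insert, Finset.mem_singleton, not_or] at hn
    rcases hout n with h | h | h | h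
    · have h' : (n:ℝ) ≤ -k - 1 := by exact_mod_cast h
      rw [Real.sign_of_neg (show y + n < 0 by linarith), Real.sign_of_neg (by linarith)]; simp
    · have h' : (2:ℝ) - k ≤ n := by exact_mod_cast h
      rw [Real.sign_of_pos (show 0 < y + n by linarith), Real.sign_of_pos (by linarith)]; simp
    · exact absurd h hn.1
    · exact absurd h hn.2
  have hS := hasSum_sum_of_ne_finset_zero (L := SummationFilter.unconditional ℤ) hz
  suffices hh : -2 * (s + L / 2 + L * B1 y) = _ from hh ▸ hS
  rw [Finset.sum_pair (by omega)]
  have e1 : y + ((-k : ℤ):ℝ) = f := by push_cast; linarith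
  have e2 : y + ((1 - k : ℤ):ℝ) = f + 1 := by push_cast; linarith
  rw [e1, e2, Real.sign_of_neg (show f - 1 < 0 by linarith),
    Real.sign_of_pos (show 0 < f + 1 by linarith), add_sub_cancel_right]
  unfold B1
  push_cast
  change _ * (_ + L * (if f = 0 then _ else f - 1 / 2)) = _
  rw [← hy]
  rcases hf0.eq_or_lt with h | h
  · rw [← h]; simp; ring
  · rw [if_neg h.ne', Real.sign_of_pos h]; ring

lemma core (x s L y : ℝ) (hx : 0 < x) (hL : 0 < L) :
    HasSum (fun n : ℤ => ∫ r in (-(y * L) - n * L)..(-(y * L) - n * L + L),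
        fk x r * (r - (-(y * L) - n * L) + s))
      (-L * (∑' n : ℤ, bet x (-(y * L) - n * L)) + (s + L / 2 + L * B1 y) * K0 x) := by
  simp only [tilde_id x s _ L hx]
  have hP := (summ_P x s (-(y * L)) L hx hL).hasSum
  have hP' := (Equiv.hasSum_iff (Equiv.subRight (1:ℤ))).2 hP
  have hB := (summ_bet x (-(y * L)) L hx hL).hasSum
  have hB' := (Equiv.hasSum_iff (Equiv.subRight (1:ℤ))).2 hB
  have e : ∀ n : ℤ, -(y * L) - n * L + L = -(y * L) - ((n - 1 : ℤ) : ℝ) * L := by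
    intro n; push_cast; ring
  have := ((hP'.sub hP).sub (hB'.mul_left L)).sub ((hasSum_fin s L y hL).mul_left (Ff x 0))
  simp only [Function.comp, Equiv.subRight_apply, ← e] at this
  have hv : ∀ a b : ℝ, a = b → ∀ g : ℤ → ℝ, HasSum g a → HasSum g b := by
    rintro a b rfl g hg; exact hg
  refine hv _ _ ?_ _ this
  rw [K0_eq]; ring

lemma kern (w1 w2 t : ℝ) (h : w1 * w2 ≠ 0) (ht : 0 < t) :
    Real.exp (-(2 * π * Q0 (w1, w2))) * Real.exp (-(4 * π * (lamM (w1, w2) t)^2)) =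
      fk (2 * π * |w1 * w2|) (Real.log t - Real.log |w1 / w2| / 2) := by
  have h1 : w1 ≠ 0 := left_ne_zero_of_mul h
  have h2 : w2 ≠ 0 := right_ne_zero_of_mul h
  have a1 : 0 < |w1| := abs_pos.2 h1
  have a2 : 0 < |w2| := abs_pos.2 h2
  unfold fk Q0 lamM
  rw [← Real.exp_add]
  congr 1
  have e : 2 * (Real.log t - Real.log |w1 / w2| / 2) = Real.log (t ^ 2 / |w1 / w2|) := by
    rw [Real.log_div (by positivity) (by positivity), Real.log_pow]; push_cast; ring
  rw [e, Real.cosh_eq, Real.exp_neg, Real.exp_log (by positivity), abs_mul, abs_div]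
  have s1 : w1 ^ 2 = |w1| ^ 2 := (sq_abs w1).symm
  have s2 : w2 ^ 2 = |w2| ^ 2 := (sq_abs w2).symm
  simp only
  have : -(2 * π * (w1 * w2)) + -(4 * π * ((-w1 / t + w2 * t) / 2) ^ 2) =
    -π * (w1 ^ 2 / t ^ 2 + w2 ^ 2 * t ^ 2) := by field_simp; ring
  rw [this, s1, s2]
  field_simp
  ring

lemma tilde_eq (ε t₀ w1 w2 : ℝ) (hε : 1 < ε) (ht₀ : 0 < t₀) (h : w1 * w2 ≠ 0) :
    betaTilde ε t₀ (w1, w2) =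
      ∫ r in (Real.log t₀ - Real.log |w1 / w2| / 2)..
          (Real.log t₀ - Real.log |w1 / w2| / 2 + Real.log ε),
        fk (2 * π * |w1 * w2|) r *
          (r - (Real.log t₀ - Real.log |w1 / w2| / 2) + Real.log t₀) := by
  unfold betaTilde
  set a := Real.log |w1 / w2| / 2
  have hle : t₀ ≤ t₀ * ε := by nlinarith
  have hpos : ∀ t ∈ Set.uIcc t₀ (t₀ * ε), 0 < t := by
    intro t ht; rw [Set.uIcc_of_le hle] at ht; exact ht₀.trans_le ht.1
  have sub := intervalIntegral.integral_comp_mul_deriv (a := t₀) (b := t₀ * ε)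
    (f := fun t => Real.log t - a) (f' := fun t => t⁻¹)
    (g := fun r => fk (2 * π * |w1 * w2|) r * (r - (Real.log t₀ - a) + Real.log t₀))
    (fun t ht => (Real.hasDerivAt_log (hpos t ht).ne').sub_const a)
    (continuousOn_id.inv₀ (fun t ht => (hpos t ht).ne'))
    ((fk_cont _).mul (by fun_prop))
  have e : Real.log (t₀ * ε) - a = Real.log t₀ - a + Real.log ε := by
    rw [Real.log_mul ht₀.ne' (by linarith)]; ring
  simp only [e] at sub
  rw [← sub, ← intervalIntegral.integral_const_mul]
  apply intervalIntegral.integral_congr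
  intro t ht
  simp only [Function.comp]
  rw [← kern w1 w2 t h (hpos t ht)]
  ring

lemma image_Ioi (t₀ a : ℝ) (ht₀ : 0 < t₀) :
    (fun t => Real.log t - a) '' Set.Ioi t₀ = Set.Ioi (Real.log t₀ - a) := by
  ext u
  simp only [Set.mem_image, Set.mem_Ioi]
  constructor
  · rintro ⟨t, ht, rfl⟩
    have := Real.log_lt_log ht₀ ht
    linarith
  · intro hu
    refine ⟨Real.exp (u + a), ?_, by simp⟩
    rw [← Real.log_lt_iff_lt_exp ht₀]; linarith

lemma image_Ioc (t₀ a : ℝ) (ht₀ : 0 < t₀) :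
    (fun t => Real.log t - a) '' Set.Ioc 0 t₀ = Set.Iic (Real.log t₀ - a) := by
  ext u
  simp only [Set.mem_image, Set.mem_Iic, Set.mem_Ioc]
  constructor
  · rintro ⟨t, ht, rfl⟩
    have := Real.log_le_log ht.1 ht.2
    linarith
  · intro hu
    refine ⟨Real.exp (u + a), ⟨Real.exp_pos _, ?_⟩, by simp⟩
    rw [← Real.le_log_iff_exp_le ht₀]; linarith

lemma subst_set (w1 w2 : ℝ) (h : w1 * w2 ≠ 0) (S : Set ℝ) (hS : MeasurableSet S)
    (hpos : ∀ t ∈ S, 0 < t) :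
    Real.exp (-(2 * π * Q0 (w1, w2))) *
        ∫ t in S, Real.exp (-(4 * π * (lamM (w1, w2) t)^2)) / t =
      ∫ u in (fun t => Real.log t - Real.log |w1 / w2| / 2) '' S, fk (2 * π * |w1 * w2|) u := by
  rw [integral_image_eq_integral_abs_deriv_smul (f' := fun t => t⁻¹) hS
    (fun t ht => ((Real.hasDerivAt_log (hpos t ht).ne').sub_const _).hasDerivWithinAt)
    (fun t ht t' ht' e => Real.log_injOn_pos (hpos t ht) (hpos t' ht') (by simpa using e)),
    ← integral_const_mul]
  apply setIntegral_congr_fun hS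
  intro t ht
  simp only [smul_eq_mul]
  rw [← kern w1 w2 t h (hpos t ht), abs_of_pos (inv_pos.2 (hpos t ht))]
  ring

lemma beta_eq (t₀ w1 w2 : ℝ) (ht₀ : 0 < t₀) (h : w1 * w2 ≠ 0) :
    betaF t₀ (w1, w2) =
      bet (2 * π * |w1 * w2|) (Real.log t₀ - Real.log |w1 / w2| / 2) := by
  have h1 : w1 ≠ 0 := left_ne_zero_of_mul h
  have h2 : w2 ≠ 0 := right_ne_zero_of_mul h
  have a1 : 0 < |w1| := abs_pos.2 h1
  have a2 : 0 < |w2| := abs_pos.2 h2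
  have prod : lamM (w1, w2) t₀ * lamP (w1, w2) t₀ =
      (t₀ ^ 2 * |w2| + |w1|) * |w2| / (4 * t₀ ^ 2) * (t₀ ^ 2 - |w1 / w2|) := by
    unfold lamM lamP
    rw [abs_div]
    have s1 : w1 ^ 2 = |w1| ^ 2 := (sq_abs w1).symm
    have s2 : w2 ^ 2 = |w2| ^ 2 := (sq_abs w2).symm
    simp only
    have : (-w1 / t₀ + w2 * t₀) / 2 * ((w1 / t₀ + w2 * t₀) / 2) =
      (w2 ^ 2 * t₀ ^ 2 - w1 ^ 2 / t₀ ^ 2) / 4 := by field_simp; ring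
    rw [this, s1, s2]
    field_simp
    ring
  have cpos : 0 < (t₀ ^ 2 * |w2| + |w1|) * |w2| / (4 * t₀ ^ 2) := by positivity
  have rpos : 0 < |w1 / w2| := by positivity
  have lg : Real.log (t₀ ^ 2) = 2 * Real.log t₀ := by rw [Real.log_pow]; norm_num
  unfold betaF bet
  rw [prod]
  rcases lt_trichotomy (t₀ ^ 2) |w1 / w2| with hlt | heq | hgt
  · have hl := Real.log_lt_log (by positivity) hlt
    have hu : Real.log t₀ - Real.log |w1 / w2| / 2 < 0 := by linarith
    have hn := mul_neg_of_pos_of_neg cpos (sub_neg.2 hlt)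
    rw [if_neg (not_lt.2 hn.le), if_pos hn, Real.sign_of_neg hu, abs_of_neg hu,
      subst_set w1 w2 h _ measurableSet_Ioc (fun t ht => ht.1), image_Ioc _ _ ht₀]
    unfold Ff
    rw [← integral_comp_neg_Iic]
    simp only [fk_neg]
    ring
  · rw [heq]
    have : Real.log t₀ - Real.log |w1 / w2| / 2 = 0 := by rw [← heq, lg]; ring
    rw [this]
    simp
  · have hl := Real.log_lt_log rpos hgt
    have hu : 0 < Real.log t₀ - Real.log |w1 / w2| / 2 := by linarith
    rw [if_pos (mul_pos cpos (sub_pos.2 hgt)), Real.sign_of_pos hu, abs_of_pos hu,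
      subst_set w1 w2 h _ measurableSet_Ioi (fun t ht => ht₀.trans ht), image_Ioi _ _ ht₀]
    unfold Ff
    ring

/-- Comparison of `∑_n β̃_{t₀}(√v λₙ)` and `∑_n β_{t₀}(√v λₙ)` along the orbit
`λₙ = (εⁿλ₁, ε⁻ⁿλ₂)`:
`∑ β̃ = −log ε · ∑ β + c̃_{t₀}(λ) K₀(2π|λ₁λ₂|v)`. -/
theorem sum_betaTilde_eq (ε t₀ v : ℝ) (hε : 1 < ε) (ht₀ : 0 < t₀) (hv : 0 < v)
    (lam : ℝ × ℝ) (hlam : lam.1 * lam.2 ≠ 0) :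
    Summable (fun n : ℤ =>
        betaTilde ε t₀ (Real.sqrt v * (ε ^ n * lam.1), Real.sqrt v * (ε ^ (-n) * lam.2))) ∧
    Summable (fun n : ℤ =>
        betaF t₀ (Real.sqrt v * (ε ^ n * lam.1), Real.sqrt v * (ε ^ (-n) * lam.2))) ∧
    ∑' n : ℤ, betaTilde ε t₀ (Real.sqrt v * (ε ^ n * lam.1), Real.sqrt v * (ε ^ (-n) * lam.2))
      = -Real.log ε *
          ∑' n : ℤ, betaF t₀ (Real.sqrt v * (ε ^ n * lam.1), Real.sqrt v * (ε ^ (-n) * lam.2))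
        + cTilde ε t₀ lam * K0 (2 * π * |lam.1 * lam.2| * v) := by
  have h1 : lam.1 ≠ 0 := left_ne_zero_of_mul hlam
  have h2 : lam.2 ≠ 0 := right_ne_zero_of_mul hlam
  have e0 : 0 < ε := by linarith
  have hL : 0 < Real.log ε := Real.log_pos hε
  have sv : 0 < Real.sqrt v := Real.sqrt_pos.2 hv
  have hr : 0 < |lam.1 / lam.2| := abs_pos.2 (div_ne_zero h1 h2)
  set L := Real.log ε with hLdef
  have hprod : ∀ n : ℤ, Real.sqrt v * (ε ^ n * lam.1) * (Real.sqrt v * (ε ^ (-n) * lam.2)) =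
      lam.1 * lam.2 * v := by
    intro n
    have : ε ^ n ≠ 0 := (zpow_pos e0 n).ne'
    rw [zpow_neg]
    field_simp
    rw [Real.sq_sqrt hv.le]
  have hne : ∀ n : ℤ, Real.sqrt v * (ε ^ n * lam.1) * (Real.sqrt v * (ε ^ (-n) * lam.2)) ≠ 0 := by
    intro n; rw [hprod]; exact mul_ne_zero hlam hv.ne'
  have hx : ∀ n : ℤ, 2 * π * |Real.sqrt v * (ε ^ n * lam.1) * (Real.sqrt v * (ε ^ (-n) * lam.2))| =
      2 * π * |lam.1 * lam.2| * v := by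
    intro n; rw [hprod, abs_mul, abs_of_pos hv]; ring
  set y := Real.log (|lam.1 / lam.2| / t₀ ^ 2) / (2 * L) with hy
  have hyL : y * L = Real.log |lam.1 / lam.2| / 2 - Real.log t₀ := by
    rw [hy, Real.log_div hr.ne' (by positivity), Real.log_pow]; push_cast; field_simp
  have hu : ∀ n : ℤ, Real.log t₀ -
      Real.log |Real.sqrt v * (ε ^ n * lam.1) / (Real.sqrt v * (ε ^ (-n) * lam.2))| / 2 =
      -(y * L) - n * L := by
    intro n
    have hz : 0 < ε ^ n := zpow_pos e0 n
    have : Real.sqrt v * (ε ^ n * lam.1) / (Real.sqrt v * (ε ^ (-n) * lam.2)) =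
        ε ^ n * ε ^ n * (lam.1 / lam.2) := by
      rw [zpow_neg]; field_simp
    rw [this, abs_mul, abs_of_pos (mul_pos hz hz), Real.log_mul (mul_pos hz hz).ne' hr.ne',
      Real.log_mul hz.ne' hz.ne', Real.log_zpow, hyL]
    ring
  have hB : ∀ n : ℤ,
      betaF t₀ (Real.sqrt v * (ε ^ n * lam.1), Real.sqrt v * (ε ^ (-n) * lam.2)) =
      bet (2 * π * |lam.1 * lam.2| * v) (-(y * L) - n * L) := by
    intro n; rw [beta_eq t₀ _ _ ht₀ (hne n), hx, hu]
  have hT : ∀ n : ℤ,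
      betaTilde ε t₀ (Real.sqrt v * (ε ^ n * lam.1), Real.sqrt v * (ε ^ (-n) * lam.2)) =
      ∫ r in (-(y * L) - n * L)..(-(y * L) - n * L + L),
        fk (2 * π * |lam.1 * lam.2| * v) r * (r - (-(y * L) - n * L) + Real.log t₀) := by
    intro n; rw [tilde_eq ε t₀ _ _ hε ht₀ (hne n), hx, hu]
  have hxp : 0 < 2 * π * |lam.1 * lam.2| * v := by
    have := abs_pos.2 hlam
    positivity
  have hc : cTilde ε t₀ lam = Real.log t₀ + L / 2 + L * B1 y := by
    unfold cTilde
    rw [Real.log_mul (by positivity) e0.ne', Real.log_pow]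
    push_cast
    ring
  have main := core (2 * π * |lam.1 * lam.2| * v) (Real.log t₀) L y hxp hL
  simp only [hB, hT, hc]
  exact ⟨main.summable, summ_bet _ _ _ hxp hL, main.tsum_eq⟩
end

section
/- Let ε > 1, 0 < t₁ < t₂, and λ = (λ₁,λ₂) ∈ ℝ² with λ₁λ₂ ≠ 0, and set λₙ := (ε^n·λ₁, ε^{−n}·λ₂) for n ∈ ℤ. Then a_{λₙ}(t₁,t₂) is nonzero for only finitely many n ∈ ℤ, and −log(ε)·∑_{n∈ℤ} a_{λₙ}(t₁,t₂) = c̃_{t₁}(λ) − c̃_{t₂}(λ). -/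
open Real MeasureTheory

lemma sgn_aux (K L y₁ y₂ : ℝ) (hK : 0 < K) (hL : 0 < L) (hy : y₂ < y₁) :
    (1 - Real.sign (K * (1 - Real.exp (2 * L * y₁)) * (1 - Real.exp (2 * L * y₂)))) / 2
      = ((if 0 < y₁ ∧ y₂ ≤ 0 then (1:ℝ) else 0) + (if 0 ≤ y₁ ∧ y₂ < 0 then (1:ℝ) else 0)) / 2 := by
  have neg : ∀ y : ℝ, y < 0 → 0 < 1 - Real.exp (2 * L * y) := fun y h => by
    have : Real.exp (2 * L * y) < 1 := Real.exp_lt_one_iff.2 (by nlinarith [mul_pos hL (neg_pos.2 h)])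
    linarith
  have pos : ∀ y : ℝ, 0 < y → 1 - Real.exp (2 * L * y) < 0 := fun y h => by
    have : 1 < Real.exp (2 * L * y) := Real.one_lt_exp_iff.2 (by positivity)
    linarith
  rcases lt_trichotomy y₁ 0 with h1 | h1 | h1
  · have h2 : y₂ < 0 := by linarith
    rw [Real.sign_of_pos (mul_pos (mul_pos hK (neg _ h1)) (neg _ h2))]
    rw [if_neg (by intro h; linarith [h.1]), if_neg (by intro h; linarith [h.1])]; norm_num
  · subst h1
    simp [hy]
  · rcases lt_trichotomy y₂ 0 with h2 | h2 | h2
    · rw [Real.sign_of_neg (mul_neg_of_neg_of_pos (mul_neg_of_pos_of_neg hK (pos _ h1)) (neg _ h2))]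
      rw [if_pos ⟨h1, h2.le⟩, if_pos ⟨h1.le, h2⟩]; norm_num
    · subst h2
      simp [h1]
    · rw [Real.sign_of_pos
        (mul_pos_of_neg_of_neg (mul_neg_of_pos_of_neg hK (pos _ h1)) (pos _ h2))]
      rw [if_neg (by intro h; linarith [h.2]), if_neg (by intro h; linarith [h.2])]; norm_num

lemma exp_aux (ε : ℝ) (hε : 1 < ε) (t : ℝ) (ht : 0 < t) (r : ℝ) (hr : 0 < r) (n : ℤ) :
    Real.exp (2 * Real.log ε * (n + Real.log (r / t^2) / (2 * Real.log ε)))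
      = (ε ^ n) ^ 2 * r / t ^ 2 := by
  have hL : 0 < Real.log ε := Real.log_pos hε
  have e0 : 0 < ε := by linarith
  have : 2 * Real.log ε * (n + Real.log (r / t^2) / (2 * Real.log ε))
      = Real.log ((ε ^ n) ^ 2 * (r / t ^ 2)) := by
    rw [Real.log_mul (by positivity) (by positivity), Real.log_pow, Real.log_zpow]
    field_simp
    push_cast
    ring
  rw [this, Real.exp_log (by positivity)]; ring

lemma aCoef_aux (ε : ℝ) (hε : 1 < ε) (t₁ t₂ : ℝ)
    (ht₁ : 0 < t₁) (ht₂ : 0 < t₂) (a b : ℝ) (hlam : a * b ≠ 0) (n : ℤ) :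
    ∃ K : ℝ, 0 < K ∧ aCoef t₁ t₂ (ε ^ n * a, ε ^ (-n) * b) =
      (1 - Real.sign (K *
        (1 - Real.exp (2 * Real.log ε * (n + Real.log (|a / b| / t₁^2) / (2 * Real.log ε)))) *
        (1 - Real.exp (2 * Real.log ε * (n + Real.log (|a / b| / t₂^2) / (2 * Real.log ε)))))) / 2
      := by
  have ha : a ≠ 0 := left_ne_zero_of_mul hlam
  have hb : b ≠ 0 := right_ne_zero_of_mul hlam
  have e0 : 0 < ε ^ n := zpow_pos (by linarith) n
  have hr : 0 < |a / b| := abs_pos.2 (div_ne_zero ha hb)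
  rw [exp_aux ε hε t₁ ht₁ _ hr, exp_aux ε hε t₂ ht₂ _ hr]
  refine ⟨b ^ 2 * t₁ * t₂ / (4 * (ε ^ n) ^ 2), by positivity, ?_⟩
  have hQ : Q0 (ε ^ n * a, ε ^ (-n) * b) = a * b := by
    simp only [Q0, zpow_neg]; field_simp
  unfold aCoef
  rw [hQ]
  have hab : a / b = a * b / b ^ 2 := by field_simp
  split_ifs with h
  · have : |a / b| = - (a / b) := abs_of_neg (by rw [hab]; exact div_neg_of_neg_of_pos h (by positivity))
    rw [this]
    congr 3
    simp only [lamP, zpow_neg]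
    field_simp
    ring
  · have : |a / b| = a / b := abs_of_nonneg (by rw [hab]; exact div_nonneg (not_lt.1 h) (by positivity))
    rw [this]
    congr 3
    simp only [lamM, zpow_neg]
    field_simp
    ring

lemma B1_aux (x : ℝ) : x - B1 x = ((⌊x⌋ : ℝ) + ⌈x⌉) / 2 := by
  unfold B1
  have := Int.self_sub_floor x
  split_ifs with h
  · have h2 : (⌊x⌋ : ℝ) = x := by linarith
    have : ⌈x⌉ = ⌊x⌋ := by
      conv_lhs => rw [← h2]
      simp
    rw [this]; linarith
  · have : ⌈x⌉ = ⌊x⌋ + 1 := by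
      rw [Int.ceil_eq_iff]
      have h1 := Int.fract_nonneg x
      have h2 := Int.lt_floor_add_one x
      have h3 : 0 < Int.fract x := lt_of_le_of_ne h1 (Ne.symm h)
      push_cast
      constructor <;> linarith
    rw [this]; push_cast; linarith

lemma hasSum_ind (s : Finset ℤ) : HasSum (fun n : ℤ => if n ∈ s then (1:ℝ) else 0) s.card := by
  have := hasSum_sum_of_ne_finset_zero (L := .unconditional ℤ) (f := fun n : ℤ => if n ∈ s then (1:ℝ) else 0) (s := s)
    (fun b hb => if_neg hb)
  simpa using this

/-- Along the orbit `λₙ = (εⁿλ₁, ε⁻ⁿλ₂)`, only finitely many coefficients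
`a_{λₙ}(t₁,t₂)` are nonzero, and `−log ε · ∑_n a_{λₙ}(t₁,t₂) = c̃_{t₁}(λ) − c̃_{t₂}(λ)`. -/
theorem sum_aCoef_eq_cTilde_diff (ε : ℝ) (hε : 1 < ε) (t₁ t₂ : ℝ)
    (ht₁ : 0 < t₁) (ht₁₂ : t₁ < t₂) (lam : ℝ × ℝ) (hlam : lam.1 * lam.2 ≠ 0) :
    (Function.support (fun n : ℤ => aCoef t₁ t₂ (ε ^ n * lam.1, ε ^ (-n) * lam.2))).Finite ∧
    -Real.log ε * ∑' n : ℤ, aCoef t₁ t₂ (ε ^ n * lam.1, ε ^ (-n) * lam.2)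
      = cTilde ε t₁ lam - cTilde ε t₂ lam := by
  have ht₂ : 0 < t₂ := ht₁.trans ht₁₂
  have hL : 0 < Real.log ε := Real.log_pos hε
  obtain ⟨a, b⟩ := lam
  simp only at hlam ⊢
  have ha : a ≠ 0 := left_ne_zero_of_mul hlam
  have hb : b ≠ 0 := right_ne_zero_of_mul hlam
  have hr : 0 < |a / b| := abs_pos.2 (div_ne_zero ha hb)
  obtain ⟨x₁, hx₁⟩ : ∃ x, x = Real.log (|a / b| / t₁^2) / (2 * Real.log ε) := ⟨_, rfl⟩
  obtain ⟨x₂, hx₂⟩ : ∃ x, x = Real.log (|a / b| / t₂^2) / (2 * Real.log ε) := ⟨_, rfl⟩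
  have hd : Real.log ε * (x₁ - x₂) = Real.log t₂ - Real.log t₁ := by
    rw [hx₁, hx₂, Real.log_div hr.ne' (by positivity), Real.log_div hr.ne' (by positivity),
      Real.log_pow, Real.log_pow]
    field_simp
    push_cast
    ring
  have hx : x₂ < x₁ := by
    have := Real.log_lt_log ht₁ ht₁₂
    by_contra hc
    nlinarith [not_lt.1 hc]
  have key : (fun n : ℤ => aCoef t₁ t₂ (ε ^ n * a, ε ^ (-n) * b)) = fun n : ℤ =>
      ((if n ∈ Finset.Ioc (-⌈x₁⌉) (-⌈x₂⌉) then (1:ℝ) else 0) +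
       (if n ∈ Finset.Ico (-⌊x₁⌋) (-⌊x₂⌋) then (1:ℝ) else 0)) / 2 := by
    funext n
    obtain ⟨K, hK, h⟩ := aCoef_aux ε hε t₁ t₂ ht₁ ht₂ a b hlam n
    rw [h, ← hx₁, ← hx₂, sgn_aux K _ _ _ hK hL (by linarith)]
    have p1 : 0 < (n:ℝ) + x₁ ↔ -⌈x₁⌉ < n := by
      rw [neg_lt, Int.lt_ceil]; push_cast; constructor <;> intro h <;> linarith
    have p2 : (n:ℝ) + x₂ ≤ 0 ↔ n ≤ -⌈x₂⌉ := by
      rw [le_neg, Int.ceil_le]; push_cast; constructor <;> intro h <;> linarith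
    have p3 : 0 ≤ (n:ℝ) + x₁ ↔ -⌊x₁⌋ ≤ n := by
      rw [neg_le, Int.le_floor]; push_cast; constructor <;> intro h <;> linarith
    have p4 : (n:ℝ) + x₂ < 0 ↔ n < -⌊x₂⌋ := by
      rw [lt_neg, Int.floor_lt]; push_cast; constructor <;> intro h <;> linarith
    simp only [p1, p2, p3, p4, Finset.mem_Ioc, Finset.mem_Ico]
  rw [key]
  constructor
  · refine (Finset.Ioc (-⌈x₁⌉) (-⌈x₂⌉) ∪ Finset.Ico (-⌊x₁⌋) (-⌊x₂⌋)).finite_toSet.subset ?_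
    intro n hn
    by_contra hc
    rw [Finset.mem_coe, Finset.mem_union, not_or] at hc
    apply hn
    simp only [if_neg hc.1, if_neg hc.2]
    norm_num
  · rw [(((hasSum_ind _).add (hasSum_ind _)).div_const 2).tsum_eq, Int.card_Ioc, Int.card_Ico]
    have c1 : (((-⌈x₂⌉ - -⌈x₁⌉).toNat : ℕ) : ℝ) = ⌈x₁⌉ - ⌈x₂⌉ := by
      have := Int.toNat_of_nonneg (a := -⌈x₂⌉ - -⌈x₁⌉) (by linarith [Int.ceil_mono hx.le])
      rw [← Int.cast_natCast, this]; push_cast; ring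
    have c2 : (((-⌊x₂⌋ - -⌊x₁⌋).toNat : ℕ) : ℝ) = ⌊x₁⌋ - ⌊x₂⌋ := by
      have := Int.toNat_of_nonneg (a := -⌊x₂⌋ - -⌊x₁⌋) (by linarith [Int.floor_mono hx.le])
      rw [← Int.cast_natCast, this]; push_cast; ring
    rw [c1, c2]
    unfold cTilde
    simp only
    rw [← hx₁, ← hx₂, Real.log_mul (by positivity) (by positivity),
      Real.log_mul (by positivity) (by positivity), Real.log_pow, Real.log_pow]
    push_cast
    have b1 := B1_aux x₁
    have b2 := B1_aux x₂
    linear_combination (Real.log ε) * b1 - (Real.log ε) * b2 - hd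
end

section
/- Let ε > 1, 0 < t₁ < t₂, and λ = (λ₁,λ₂) ∈ ℝ² with λ₁λ₂ ≠ 0, normalized so that t₁ ≤ |λ₁/λ₂|^{1/2} < t₁·ε. Let N ∈ ℕ₀ be such that t₁·ε^N ≤ t₂ < t₁·ε^{N+1}, and suppose |λ₁/λ₂|^{1/2}·ε^N ≤ t₂. Setting λₙ := (ε^n·λ₁, ε^{−n}·λ₂), one has ∑_{n∈ℤ} a_{λₙ}(t₁,t₂) = N + 1 − (1/2)·(𝟙[t₁² = |λ₁/λ₂|] + 𝟙[t₂² = |λ₁/λ₂|·ε^{2N}]), where 𝟙[·] is 1 if the condition holds and 0 otherwise. -/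
open Real MeasureTheory

theorem sign_pos_mul_aux (c x : ℝ) (hc : 0 < c) : Real.sign (c * x) = Real.sign x := by
  rcases lt_trichotomy x 0 with h | h | h
  · rw [Real.sign_of_neg h, Real.sign_of_neg (mul_neg_of_pos_of_neg hc h)]
  · simp [h]
  · rw [Real.sign_of_pos h, Real.sign_of_pos (mul_pos hc h)]

theorem aCoef_eq_aux (t₁ t₂ : ℝ) (ht₁ : 0 < t₁) (ht₂ : 0 < t₂) (a b s : ℝ) (hs : 0 < s)
    (hab : a * b ≠ 0) (h : |a / b| = s ^ 2) :
    aCoef t₁ t₂ (a, b) = (1 - Real.sign ((t₁ - s) * (t₂ - s))) / 2 := by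
  have hb : b ≠ 0 := right_ne_zero_of_mul hab
  have hc : 0 < b ^ 2 * (t₁ + s) * (t₂ + s) / (4 * t₁ * t₂) := by positivity
  have hb2 : 0 < b ^ 2 := by positivity
  have hdiv : a / b = a * b / b ^ 2 := by field_simp
  unfold aCoef Q0 lamP lamM
  dsimp only
  split_ifs with hq
  · have h1 : a / b < 0 := by rw [hdiv]; exact div_neg_of_neg_of_pos hq hb2
    rw [abs_of_neg h1] at h
    have ha : a = -(s ^ 2) * b := by rw [← h]; field_simp
    rw [← sign_pos_mul_aux _ ((t₁ - s) * (t₂ - s)) hc]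
    congr 3
    rw [ha]; field_simp; ring
  · have h1 : 0 < a / b := by
      rw [hdiv]; exact div_pos (lt_of_le_of_ne (not_lt.mp hq) (Ne.symm hab)) hb2
    rw [abs_of_pos h1] at h
    have ha : a = (s ^ 2) * b := by rw [← h]; field_simp
    rw [← sign_pos_mul_aux _ ((t₁ - s) * (t₂ - s)) hc]
    congr 3
    rw [ha]; field_simp; ring

/-- Counting the orbit sum `∑_n a_{λₙ}(t₁,t₂)` for the normalized representative:
if `t₁ ≤ |λ₁/λ₂|^{1/2} < t₁ε`, `t₁εᴺ ≤ t₂ < t₁ε^{N+1}` and `|λ₁/λ₂|^{1/2}εᴺ ≤ t₂`, then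
`∑_n a_{λₙ}(t₁,t₂) = N + 1 − (δ_{t₁²=|λ₁/λ₂|} + δ_{t₂²=|λ₁/λ₂|ε^{2N}})/2`. -/
theorem sum_aCoef_count (ε : ℝ) (hε : 1 < ε) (t₁ t₂ : ℝ)
    (ht₁ : 0 < t₁) (ht₁₂ : t₁ < t₂) (lam : ℝ × ℝ) (hlam : lam.1 * lam.2 ≠ 0)
    (hnorm₁ : t₁ ≤ Real.sqrt |lam.1 / lam.2|) (hnorm₂ : Real.sqrt |lam.1 / lam.2| < t₁ * ε)
    (N : ℕ) (hN₁ : t₁ * ε ^ N ≤ t₂) (hN₂ : t₂ < t₁ * ε ^ (N + 1))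
    (hsup : Real.sqrt |lam.1 / lam.2| * ε ^ N ≤ t₂) :
    ∑' n : ℤ, aCoef t₁ t₂ (ε ^ n * lam.1, ε ^ (-n) * lam.2)
      = N + 1 - (1/2) * ((if t₁^2 = |lam.1 / lam.2| then 1 else 0)
          + (if t₂^2 = |lam.1 / lam.2| * ε ^ (2 * N) then 1 else 0)) := by
  have hε0 : 0 < ε := by linarith
  have ht₂ : 0 < t₂ := by linarith
  set r := Real.sqrt |lam.1 / lam.2| with hr
  have hr0 : 0 < r := by linarith
  have hr2 : |lam.1 / lam.2| = r ^ 2 := (Real.sq_sqrt (abs_nonneg _)).symm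
  have hl2 : lam.2 ≠ 0 := right_ne_zero_of_mul hlam
  have key : ∀ n : ℤ, aCoef t₁ t₂ (ε ^ n * lam.1, ε ^ (-n) * lam.2)
      = (1 - Real.sign ((t₁ - r * ε ^ n) * (t₂ - r * ε ^ n))) / 2 := by
    intro n
    have hn : 0 < ε ^ n := zpow_pos hε0 n
    apply aCoef_eq_aux t₁ t₂ ht₁ ht₂ _ _ _ (by positivity)
    · rw [zpow_neg]
      have : ε ^ n * lam.1 * ((ε ^ n)⁻¹ * lam.2) = lam.1 * lam.2 := by field_simp
      rw [this]; exact hlam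
    · have : ε ^ n * lam.1 / (ε ^ (-n) * lam.2) = (ε ^ n) ^ 2 * (lam.1 / lam.2) := by
        rw [zpow_neg]; field_simp
      rw [this, abs_mul, hr2, abs_of_pos (by positivity)]; ring
  have hmono : ∀ m n : ℤ, m < n → r * ε ^ m < r * ε ^ n := fun m n h =>
    mul_lt_mul_of_pos_left (zpow_lt_zpow_right₀ hε h) hr0
  have hmono' : ∀ m n : ℤ, m ≤ n → r * ε ^ m ≤ r * ε ^ n := fun m n h =>
    mul_le_mul_of_nonneg_left (zpow_le_zpow_right₀ hε.le h) hr0.le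
  have hm1 : r * ε ^ (-1 : ℤ) < t₁ := by
    rw [zpow_neg_one, ← div_eq_mul_inv, div_lt_iff₀ hε0]; exact hnorm₂
  have hN1 : t₂ < r * ε ^ ((N : ℤ) + 1) := by
    have : ε ^ ((N : ℤ) + 1) = ε ^ (N + 1) := by exact_mod_cast zpow_natCast ε (N + 1)
    rw [this]
    exact lt_of_lt_of_le hN₂ (mul_le_mul_of_nonneg_right hnorm₁ (by positivity))
  have h0 : t₁ ≤ r * ε ^ (0 : ℤ) := by simpa using hnorm₁
  have hNN : r * ε ^ (N : ℤ) ≤ t₂ := by rw [zpow_natCast]; exact hsup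
  have hout : ∀ n : ℤ, n ∉ (Finset.range (N + 1)).map Nat.castEmbedding →
      aCoef t₁ t₂ (ε ^ n * lam.1, ε ^ (-n) * lam.2) = 0 := by
    intro n hn
    rw [key]
    have hpos : 0 < (t₁ - r * ε ^ n) * (t₂ - r * ε ^ n) := by
      rcases lt_or_ge n 0 with h | h
      · have := hmono' n (-1) (by omega)
        exact mul_pos (by linarith) (by linarith)
      · have hlt : (N : ℤ) + 1 ≤ n := by
          by_contra hcon
          apply hn
          rw [Finset.mem_map]
          exact ⟨n.toNat, by rw [Finset.mem_range]; omega, by simp [h]⟩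
        have := hmono' _ _ hlt
        exact mul_pos_of_neg_of_neg (by linarith) (by linarith)
    rw [Real.sign_of_pos hpos]; norm_num
  rw [tsum_eq_sum hout, Finset.sum_map]
  have hc1 : (t₁ ^ 2 = |lam.1 / lam.2|) ↔ t₁ = r := by
    rw [hr2]; exact pow_left_inj₀ ht₁.le hr0.le (by norm_num)
  have hc2 : (t₂ ^ 2 = |lam.1 / lam.2| * ε ^ (2 * N)) ↔ t₂ = r * ε ^ N := by
    have : r ^ 2 * ε ^ (2 * N) = (r * ε ^ N) ^ 2 := by rw [mul_pow, ← pow_mul, mul_comm 2 N]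
    rw [hr2, this]; exact pow_left_inj₀ ht₂.le (by positivity) (by norm_num)
  have hin : ∀ k ∈ Finset.range (N + 1),
      aCoef t₁ t₂ (ε ^ (Nat.castEmbedding k : ℤ) * lam.1, ε ^ (-(Nat.castEmbedding k : ℤ)) * lam.2)
      = 1 - (1 / 2) * ((if k = 0 then (if t₁ = r then (1 : ℝ) else 0) else 0)
        + (if k = N then (if t₂ = r * ε ^ N then (1 : ℝ) else 0) else 0)) := by
    intro k hk
    rw [Finset.mem_range] at hk
    rw [key]
    simp only [Nat.castEmbedding_apply]
    have e1 : (if k = 0 then (if t₁ = r then (1 : ℝ) else 0) else 0)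
        = if t₁ = r * ε ^ (k : ℤ) then 1 else 0 := by
      by_cases hk0 : k = 0
      · subst hk0; simp
      · have := hmono 0 k (by omega)
        rw [if_neg hk0, if_neg (h0.trans_lt this).ne]
    have e2 : (if k = N then (if t₂ = r * ε ^ N then (1 : ℝ) else 0) else 0)
        = if t₂ = r * ε ^ (k : ℤ) then 1 else 0 := by
      by_cases hkN : k = N
      · subst hkN; simp
      · have := hmono k N (by omega)
        rw [if_neg hkN, if_neg (by intro h; linarith)]
    rw [e1, e2]
    have l1 : t₁ ≤ r * ε ^ (k : ℤ) := h0.trans (hmono' _ _ (by omega))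
    have l2 : r * ε ^ (k : ℤ) ≤ t₂ := (hmono' _ _ (by omega)).trans hNN
    generalize r * ε ^ (k : ℤ) = s at l1 l2
    rcases eq_or_lt_of_le l1 with h | h
    · rw [if_pos h, if_neg (by intro h'; linarith), h]; simp; try norm_num
    · rcases eq_or_lt_of_le l2 with h' | h'
      · rw [if_neg h.ne, if_pos h'.symm, h']; simp; try norm_num
      · rw [if_neg h.ne, if_neg h'.ne', Real.sign_of_neg
          (mul_neg_of_neg_of_pos (by linarith) (by linarith))]
        norm_num
  rw [Finset.sum_congr rfl hin]
  simp only [hc1, hc2]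
  rw [Finset.sum_sub_distrib, ← Finset.mul_sum, Finset.sum_add_distrib, Finset.sum_ite_eq',
    Finset.sum_ite_eq']
  simp
end

section
/- For all real a, b with a·b ≠ 0 and all v > 0, one has ∫_{−∞}^{∞} exp(−πv(a²e^{−2ν} + b²e^{2ν})) dν = K₀(2πv·|ab|). (This is the unfolding computation evaluating the theta integral as a K-Bessel coefficient.) -/
open Real MeasureTheory

/-- The unfolding computation:
`∫_ℝ exp(−πv(a²e^{−2ν} + b²e^{2ν})) dν = K₀(2πv|ab|)` for `ab ≠ 0`, `v > 0`. -/
theorem unfolding_integral_eq_K0 (a b : ℝ) (hab : a * b ≠ 0) (v : ℝ) (hv : 0 < v) :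
    (∫ ν : ℝ, Real.exp (-(π * v * (a^2 * Real.exp (-2 * ν) + b^2 * Real.exp (2 * ν)))))
      = K0 (2 * π * v * |a * b|) := by
  have ha : 0 < |a| := abs_pos.mpr (left_ne_zero_of_mul hab)
  have hb : 0 < |b| := abs_pos.mpr (right_ne_zero_of_mul hab)
  have key : ∀ ν : ℝ,
      Real.exp (-(π * v * (a^2 * Real.exp (-2 * ν) + b^2 * Real.exp (2 * ν))))
      = (fun y : ℝ => (fun T : ℝ => Real.exp (-(2 * π * v * |a * b|) * Real.cosh T))
          (y + Real.log (|b| / |a|))) (2 * ν) := by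
    intro ν
    have h1 : Real.exp (-(2 * ν + Real.log (|b| / |a|))) = Real.exp (-2 * ν) * (|a| / |b|) := by
      rw [neg_add, Real.exp_add, Real.exp_neg (Real.log _), Real.exp_log (by positivity), inv_div,
        neg_mul]
    have h2 : Real.exp (2 * ν + Real.log (|b| / |a|)) = Real.exp (2 * ν) * (|b| / |a|) := by
      rw [Real.exp_add, Real.exp_log (by positivity)]
    simp only [Real.cosh_eq, h1, h2, abs_mul]
    congr 1
    rw [← sq_abs a, ← sq_abs b]
    field_simp
    ring
  have h3 := integral_comp_abs (f := fun T : ℝ => Real.exp (-(2 * π * v * |a * b|) * Real.cosh T))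
  simp only [Real.cosh_abs] at h3
  simp_rw [key]
  rw [Measure.integral_comp_mul_left (fun y : ℝ => Real.exp (-(2 * π * v * |a * b|) *
    Real.cosh (y + Real.log (|b| / |a|)))), integral_add_right_eq_self
    (fun T : ℝ => Real.exp (-(2 * π * v * |a * b|) * Real.cosh T)), h3, K0]
  simp
end

section
/- For fixed (x,y) ∈ ℝ², the function F(u,v) := φ_{u+iv}(x,y) = √v·exp(2πi(x²(u+iv) − y²(u−iv))) on ℝ × (0,∞) satisfies Δ̃F = v²(∂_u² + ∂_v²)F + F/4 = ((4πvxy)² − 2πv(x² + y²))·F at every point (u,v) with v > 0. -/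
open Real MeasureTheory

/-- `φ_{u+iv}(x,y) = √v · e(x²τ − y²τ̄)` with `τ = u + iv`. -/
noncomputable def phiKer (x y u v : ℝ) : ℂ :=
  (Real.sqrt v : ℂ) * Complex.exp (2 * (π:ℂ) * Complex.I *
    ((x:ℂ)^2 * ((u:ℂ) + (v:ℂ) * Complex.I) - (y:ℂ)^2 * ((u:ℂ) - (v:ℂ) * Complex.I)))

theorem phiKer_hasDerivAt_u (x y u v : ℝ) :
    HasDerivAt (fun u' : ℝ => phiKer x y u' v)
      (2 * (π:ℂ) * Complex.I * ((x:ℂ)^2 - (y:ℂ)^2) * phiKer x y u v) u := by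
  unfold phiKer
  have h0 : HasDerivAt (fun t : ℝ => (t:ℂ)) 1 u := Complex.ofRealCLM.hasDerivAt
  have h1 := (((((h0.add_const ((v:ℂ) * Complex.I)).const_mul ((x:ℂ)^2)).sub
    ((h0.sub_const ((v:ℂ) * Complex.I)).const_mul ((y:ℂ)^2))).const_mul
      (2 * (π:ℂ) * Complex.I)).cexp).const_mul (Real.sqrt v : ℂ)
  refine h1.congr_deriv ?_
  simp only [Pi.sub_apply]
  ring

theorem phiKer_hasDerivAt_v (x y u v : ℝ) (hv : 0 < v) :
    HasDerivAt (fun v' : ℝ => phiKer x y u v')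
      ((1 / (2 * (v:ℂ)) - 2 * (π:ℂ) * ((x:ℂ)^2 + (y:ℂ)^2)) * phiKer x y u v) v := by
  unfold phiKer
  have h0 : HasDerivAt (fun t : ℝ => (t:ℂ)) 1 v := Complex.ofRealCLM.hasDerivAt
  have hs := (Real.hasDerivAt_sqrt hv.ne').ofReal_comp
  have h1 := hs.mul ((((((h0.mul_const Complex.I).const_add (u:ℂ)).const_mul ((x:ℂ)^2)).sub
    (((h0.mul_const Complex.I).const_sub (u:ℂ)).const_mul ((y:ℂ)^2))).const_mul
      (2 * (π:ℂ) * Complex.I)).cexp)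
  refine h1.congr_deriv ?_
  have e : ((1 / (2 * Real.sqrt v) : ℝ) : ℂ) = 1 / (2 * (v:ℂ)) * (Real.sqrt v : ℂ) := by
    have : 1 / (2 * Real.sqrt v) = 1 / (2 * v) * Real.sqrt v := by
      have h2 := Real.sq_sqrt hv.le
      have h3 := Real.sqrt_pos.2 hv
      field_simp
      linarith
    rw [this]; push_cast; ring
  rw [e]
  simp only [Pi.sub_apply]
  ring_nf
  simp only [Complex.I_sq]
  ring

/-- `Δ̃ φ_τ(x,y) = ((4πvxy)² − 2πv(x²+y²)) φ_τ(x,y)`. -/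
theorem phiKer_laplacian (x y u v : ℝ) (hv : 0 < v) :
    (v:ℂ)^2 * (deriv (fun u' : ℝ => deriv (fun u'' : ℝ => phiKer x y u'' v) u') u
        + deriv (fun v' : ℝ => deriv (fun v'' : ℝ => phiKer x y u v'') v') v)
      + phiKer x y u v / 4
      = (((4 * π * v * x * y)^2 - 2 * π * v * (x^2 + y^2) : ℝ) : ℂ) * phiKer x y u v := by
  have hV : (v:ℂ) ≠ 0 := by exact_mod_cast hv.ne'
  have hu : (fun u' : ℝ => deriv (fun u'' : ℝ => phiKer x y u'' v) u') =
      fun u' => 2 * (π:ℂ) * Complex.I * ((x:ℂ)^2 - (y:ℂ)^2) * phiKer x y u' v :=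
    funext fun u' => (phiKer_hasDerivAt_u x y u' v).deriv
  have hvv : (fun v' : ℝ => deriv (fun v'' : ℝ => phiKer x y u v'') v') =ᶠ[nhds v]
      fun v' => (1 / 2 * ((v':ℂ))⁻¹ - 2 * (π:ℂ) * ((x:ℂ)^2 + (y:ℂ)^2)) * phiKer x y u v' := by
    filter_upwards [lt_mem_nhds hv] with w hw
    rw [(phiKer_hasDerivAt_v x y u w hw).deriv]
    ring
  have h0 : HasDerivAt (fun t : ℝ => (t:ℂ)) 1 v := Complex.ofRealCLM.hasDerivAt
  have h2 := (((h0.fun_inv hV).const_mul (1 / 2 : ℂ)).sub_const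
    (2 * (π:ℂ) * ((x:ℂ)^2 + (y:ℂ)^2))).fun_mul (phiKer_hasDerivAt_v x y u v hv)
  rw [hu, ((phiKer_hasDerivAt_u x y u v).const_mul _).deriv, hvv.deriv_eq, h2.deriv]
  push_cast
  generalize phiKer x y u v = F
  field_simp
  ring_nf
  simp only [Complex.I_sq]
  ring
end

section
/- Let t₀ > 0 and λ = (λ₁,λ₂) ∈ ℝ² with λ_{t₀}^+ ≠ 0 and λ_{t₀}^− ≠ 0. Define G(u,v) := √v·β_{t₀}(√v·λ)·exp(2πi·Q₀(λ)·u) on ℝ × (0,∞). Then Δ̃G(u,v) = 2π·λ_{t₀}^+·λ_{t₀}^−·v^{3/2}·exp(2πi((λ_{t₀}^+)²(u+iv) − (λ_{t₀}^−)²(u−iv))) for all u ∈ ℝ, v > 0. (This is the termwise form of Zwegers' theorem Δ̃φ^{c₀}_{L+h} = 2π·θ^{(1,1)}_{L+h}(·, t₀).) -/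
open Real MeasureTheory

/-- The term `G(u,v) = √v · β_{t₀}(√v·λ) · e(Q₀(λ)u)` of `φ^{c₀}_{L+h}`. -/
noncomputable def Gterm (t₀ : ℝ) (lam : ℝ × ℝ) (u v : ℝ) : ℂ :=
  (Real.sqrt v : ℂ) * (betaF t₀ (Real.sqrt v * lam.1, Real.sqrt v * lam.2) : ℂ) *
    Complex.exp (2 * (π:ℂ) * Complex.I * (Q0 lam : ℂ) * (u:ℂ))

namespace GtAux

noncomputable def hh (A B t : ℝ) : ℝ := A ^ 2 / t ^ 2 + B ^ 2 * t ^ 2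
noncomputable def kk (A B t : ℝ) : ℝ := B ^ 2 * t ^ 2 - A ^ 2 / t ^ 2

noncomputable def MM (A B : ℝ) (S : Set ℝ) (j : ℕ) (c : ℝ) : ℝ :=
  ∫ t in S, hh A B t ^ j * Real.exp (-c * hh A B t) / t

lemma hh_nonneg (A B t : ℝ) : 0 ≤ hh A B t := by unfold hh; positivity

lemma hh_meas (A B : ℝ) : Measurable (hh A B) := by unfold hh; fun_prop

lemma f_meas (A B : ℝ) (j : ℕ) (c : ℝ) :
    Measurable (fun t => hh A B t ^ j * Real.exp (-c * hh A B t) / t) := by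
  have := hh_meas A B
  fun_prop

lemma pow_exp_bound (j : ℕ) (c : ℝ) (hc : 0 < c) :
    ∃ C : ℝ, 0 ≤ C ∧ ∀ x : ℝ, 0 ≤ x → x ^ j * Real.exp (-c * x) ≤ C * Real.exp (-(c/2) * x) := by
  refine ⟨(j.factorial : ℝ) / (c/2) ^ j, by positivity, fun x hx => ?_⟩
  have h1 := Real.pow_div_factorial_le_exp (c/2*x) (by positivity) j
  have h2 : Real.exp (-c * x) = Real.exp (-(c/2) * x) * (Real.exp (c/2*x))⁻¹ := by
    rw [← Real.exp_neg, ← Real.exp_add]; congr 1; ring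
  rw [h2]
  have hf : (0:ℝ) < j.factorial := by exact_mod_cast Nat.factorial_pos j
  have h3 : x ^ j ≤ (j.factorial : ℝ) / (c/2) ^ j * Real.exp (c/2*x) := by
    rw [div_le_iff₀ hf, mul_pow] at h1
    rw [div_mul_eq_mul_div, le_div_iff₀ (by positivity)]
    linarith
  have he := Real.exp_pos (c/2*x)
  calc x ^ j * (Real.exp (-(c/2) * x) * (Real.exp (c/2*x))⁻¹)
      ≤ ((j.factorial : ℝ) / (c/2) ^ j * Real.exp (c/2*x)) *
        (Real.exp (-(c/2) * x) * (Real.exp (c/2*x))⁻¹) := by gcongr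
    _ = _ := by field_simp

lemma moment_int (A B : ℝ) (S : Set ℝ) (hS : MeasurableSet S) (hS0 : S ⊆ Set.Ioi 0)
    (H : ∀ c : ℝ, 0 < c → IntegrableOn (fun t => Real.exp (-c * hh A B t) / t) S)
    (j : ℕ) (c : ℝ) (hc : 0 < c) :
    IntegrableOn (fun t => hh A B t ^ j * Real.exp (-c * hh A B t) / t) S := by
  obtain ⟨C, hC, hb⟩ := pow_exp_bound j c hc
  refine Integrable.mono' ((H (c/2) (by positivity)).const_mul C)
    (f_meas A B j c).aestronglyMeasurable ?_
  refine (ae_restrict_iff' hS).2 (Filter.Eventually.of_forall fun t ht => ?_)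
  have ht : 0 < t := hS0 ht
  have h0 := hh_nonneg A B t
  rw [Real.norm_of_nonneg (by positivity), ← mul_div_assoc]
  have := hb _ h0
  gcongr

lemma moment_deriv (A B : ℝ) (S : Set ℝ) (hS : MeasurableSet S) (hS0 : S ⊆ Set.Ioi 0)
    (H : ∀ c : ℝ, 0 < c → IntegrableOn (fun t => Real.exp (-c * hh A B t) / t) S)
    (j : ℕ) (c : ℝ) (hc : 0 < c) :
    HasDerivAt (MM A B S j) (-MM A B S (j+1) c) c := by
  have key := hasDerivAt_integral_of_dominated_loc_of_deriv_le
    (μ := volume.restrict S) (x₀ := c) (s := Set.Ioi (c/2))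
    (F := fun c t => hh A B t ^ j * Real.exp (-c * hh A B t) / t)
    (F' := fun c t => -(hh A B t ^ (j+1) * Real.exp (-c * hh A B t) / t))
    (bound := fun t => hh A B t ^ (j+1) * Real.exp (-(c/2) * hh A B t) / t)
    (Ioi_mem_nhds (by linarith))
    (Filter.Eventually.of_forall fun x => (f_meas A B j x).aestronglyMeasurable)
    (moment_int A B S hS hS0 H j c hc)
    ((f_meas A B (j+1) c).neg.aestronglyMeasurable)
    ((ae_restrict_iff' hS).2 (Filter.Eventually.of_forall fun t ht x hx => by
      have ht : 0 < t := hS0 ht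
      have h0 := hh_nonneg A B t
      have hx : c/2 < x := hx
      rw [norm_neg, Real.norm_of_nonneg (by positivity)]
      gcongr))
    (moment_int A B S hS hS0 H (j+1) (c/2) (by positivity))
    (Filter.Eventually.of_forall fun t x _ => by
      have h1 : HasDerivAt (fun x : ℝ => -x * hh A B t) (-1 * hh A B t) x :=
        ((hasDerivAt_id x).neg).mul_const _
      exact ((h1.exp.const_mul (hh A B t ^ j)).div_const t).congr_deriv (by ring))
  have := key.2
  rw [integral_neg] at this
  exact this

lemma comb_int (A B : ℝ) (S : Set ℝ) (hS : MeasurableSet S) (hS0 : S ⊆ Set.Ioi 0)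
    (H : ∀ c : ℝ, 0 < c → IntegrableOn (fun t => Real.exp (-c * hh A B t) / t) S)
    (c : ℝ) (hc : 0 < c) :
    IntegrableOn (fun t => (2 * hh A B t - 2 * c * kk A B t ^ 2) * Real.exp (-c * hh A B t) / t) S ∧
    ∫ t in S, (2 * hh A B t - 2 * c * kk A B t ^ 2) * Real.exp (-c * hh A B t) / t =
      2 * MM A B S 1 c - 2 * c * MM A B S 2 c + 8 * c * (A * B) ^ 2 * MM A B S 0 c := by
  have i0 := (moment_int A B S hS hS0 H 0 c hc).const_mul (8 * c * (A * B) ^ 2)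
  have i1 := (moment_int A B S hS hS0 H 1 c hc).const_mul 2
  have i2 := (moment_int A B S hS hS0 H 2 c hc).const_mul (2 * c)
  have heq : ∀ t ∈ S, 2 * (hh A B t ^ 1 * Real.exp (-c * hh A B t) / t)
      - 2 * c * (hh A B t ^ 2 * Real.exp (-c * hh A B t) / t)
      + 8 * c * (A * B) ^ 2 * (hh A B t ^ 0 * Real.exp (-c * hh A B t) / t)
      = (2 * hh A B t - 2 * c * kk A B t ^ 2) * Real.exp (-c * hh A B t) / t := by
    intro t ht
    have ht : t ≠ 0 := ne_of_gt (hS0 ht)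
    have : kk A B t ^ 2 = hh A B t ^ 2 - 4 * (A * B) ^ 2 := by
      unfold kk hh; field_simp; ring
    rw [this]; ring
  constructor
  · exact IntegrableOn.congr_fun ((i1.sub i2).add i0) heq hS
  · rw [← setIntegral_congr_fun hS heq, integral_add (f := fun t => 2 * (hh A B t ^ 1 * Real.exp (-c * hh A B t) / t)
      - 2 * c * (hh A B t ^ 2 * Real.exp (-c * hh A B t) / t)) (i1.sub i2) i0, integral_sub i1 i2,
      integral_const_mul, integral_const_mul, integral_const_mul]
    rfl

lemma prim_deriv (A B c t : ℝ) (ht : 0 < t) :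
    HasDerivAt (fun t => kk A B t * Real.exp (-c * hh A B t))
      ((2 * hh A B t - 2 * c * kk A B t ^ 2) * Real.exp (-c * hh A B t) / t) t := by
  have p2 : HasDerivAt (fun t : ℝ => t ^ 2) (2 * t) t := by simpa using hasDerivAt_pow 2 t
  have q2 : HasDerivAt (fun t : ℝ => A ^ 2 / t ^ 2) (-(2 * A ^ 2 / t ^ 3)) t := by
    refine ((hasDerivAt_const t (A ^ 2)).div p2 (by positivity)).congr_deriv ?_
    field_simp; ring
  have h1 : HasDerivAt (hh A B) (2 * kk A B t / t) t := by
    refine (q2.add (p2.const_mul (B ^ 2))).congr_deriv ?_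
    unfold kk; field_simp; ring
  have h2 : HasDerivAt (kk A B) (2 * hh A B t / t) t := by
    refine ((p2.const_mul (B ^ 2)).sub q2).congr_deriv ?_
    unfold hh; field_simp; ring
  refine (h2.mul ((h1.const_mul (-c)).exp)).congr_deriv ?_
  ring

lemma prim_tendsto (A B c : ℝ) (hc : 0 < c) (l : Filter ℝ)
    (hl : Filter.Tendsto (hh A B) l Filter.atTop) :
    Filter.Tendsto (fun t => kk A B t * Real.exp (-c * hh A B t)) l (nhds 0) := by
  obtain ⟨C, hC, hb⟩ := pow_exp_bound 1 c hc
  have h1 : Filter.Tendsto (fun t => C * Real.exp (-(c/2) * hh A B t)) l (nhds (C * 0)) := by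
    refine Filter.Tendsto.const_mul C (Real.tendsto_exp_atBot.comp ?_)
    exact hl.const_mul_atTop_of_neg (by linarith)
  rw [mul_zero] at h1
  refine squeeze_zero_norm (fun t => ?_) h1
  refine le_trans ?_ (hb _ (hh_nonneg A B t))
  rw [norm_mul, Real.norm_of_nonneg (Real.exp_pos _).le, pow_one]
  gcongr
  rw [Real.norm_eq_abs, abs_le]
  have a1 : 0 ≤ A ^ 2 / t ^ 2 := by positivity
  have a2 : 0 ≤ B ^ 2 * t ^ 2 := by positivity
  unfold kk hh
  constructor <;> linarith

lemma H_Ioi (A B t₀ : ℝ) (ht₀ : 0 < t₀) (hB : B ≠ 0) (c : ℝ) (hc : 0 < c) :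
    IntegrableOn (fun t => Real.exp (-c * hh A B t) / t) (Set.Ioi t₀) := by
  have hB2 : 0 < B ^ 2 := by positivity
  have i := (exp_neg_integrableOn_Ioi t₀ (b := c * B ^ 2 * t₀) (by positivity)).div_const t₀
  have hmeas := f_meas A B 0 c
  simp only [pow_zero, one_mul] at hmeas
  refine Integrable.mono' i hmeas.aestronglyMeasurable ?_
  refine (ae_restrict_iff' measurableSet_Ioi).2 (Filter.Eventually.of_forall fun t ht => ?_)
  have ht : t₀ < t := ht
  have ht' : 0 < t := ht₀.trans ht
  rw [Real.norm_of_nonneg (by positivity)]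
  have : c * B ^ 2 * t₀ * t ≤ c * hh A B t := by
    have h1 : B ^ 2 * (t₀ * t) ≤ hh A B t := by
      have a1 : 0 ≤ A ^ 2 / t ^ 2 := by positivity
      have a2 : B ^ 2 * (t₀ * t) ≤ B ^ 2 * t ^ 2 := by
        rw [sq t]; gcongr
      unfold hh; linarith
    have := mul_le_mul_of_nonneg_left h1 hc.le
    linarith
  have h2 : -c * hh A B t ≤ -(c * B ^ 2 * t₀) * t := by linarith
  gcongr

lemma H_Ioc (A B t₀ : ℝ) (hA : A ≠ 0) (c : ℝ) (hc : 0 < c) :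
    IntegrableOn (fun t => Real.exp (-c * hh A B t) / t) (Set.Ioc 0 t₀) := by
  have hA2 : 0 < A ^ 2 := by positivity
  have hmeas := f_meas A B 0 c
  simp only [pow_zero, one_mul] at hmeas
  have i : IntegrableOn (fun _ : ℝ => t₀ / (c * A ^ 2)) (Set.Ioc 0 t₀) := by
    apply integrableOn_const <;> simp
  refine Integrable.mono' i hmeas.aestronglyMeasurable ?_
  refine (ae_restrict_iff' measurableSet_Ioc).2 (Filter.Eventually.of_forall fun t ht => ?_)
  obtain ⟨ht, ht'⟩ := ht
  rw [Real.norm_of_nonneg (by positivity)]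
  have h1 : c * (A ^ 2 / t ^ 2) ≤ Real.exp (c * hh A B t) := by
    have a2 : 0 ≤ B ^ 2 * t ^ 2 := by positivity
    have a3 : c * (A ^ 2 / t ^ 2) ≤ c * hh A B t := by
      unfold hh; gcongr; linarith
    have := Real.add_one_le_exp (c * hh A B t)
    linarith
  have h2 : Real.exp (-c * hh A B t) ≤ (c * (A ^ 2 / t ^ 2))⁻¹ := by
    rw [neg_mul, Real.exp_neg]
    gcongr
  calc Real.exp (-c * hh A B t) / t ≤ (c * (A ^ 2 / t ^ 2))⁻¹ / t := by gcongr
    _ = t / (c * A ^ 2) := by field_simp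
    _ ≤ _ := by gcongr

lemma tend_top (A B : ℝ) (hB : B ≠ 0) : Filter.Tendsto (hh A B) Filter.atTop Filter.atTop := by
  have hB2 : 0 < B ^ 2 := by positivity
  refine Filter.tendsto_atTop_mono (f := fun t => B ^ 2 * t ^ 2) (fun t => ?_) ?_
  · have a1 : 0 ≤ A ^ 2 / t ^ 2 := by positivity
    unfold hh; linarith
  · exact (Filter.tendsto_pow_atTop two_ne_zero).const_mul_atTop hB2

lemma tend_zero (A B : ℝ) (hA : A ≠ 0) :
    Filter.Tendsto (hh A B) (nhdsWithin 0 (Set.Ioi 0)) Filter.atTop := by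
  have hA2 : 0 < A ^ 2 := by positivity
  refine Filter.tendsto_atTop_mono (f := fun t => A ^ 2 * (t⁻¹) ^ 2) (fun t => ?_) ?_
  · have a1 : 0 ≤ B ^ 2 * t ^ 2 := by positivity
    unfold hh; rw [inv_pow, ← div_eq_mul_inv]; linarith
  · exact ((Filter.tendsto_pow_atTop two_ne_zero).comp tendsto_inv_nhdsGT_zero).const_mul_atTop hA2

lemma ode_Ioi (A B t₀ : ℝ) (ht₀ : 0 < t₀) (hB : B ≠ 0) (c : ℝ) (hc : 0 < c) :
    2 * MM A B (Set.Ioi t₀) 1 c - 2 * c * MM A B (Set.Ioi t₀) 2 c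
      + 8 * c * (A * B) ^ 2 * MM A B (Set.Ioi t₀) 0 c
      = -(kk A B t₀ * Real.exp (-c * hh A B t₀)) := by
  obtain ⟨hi, he⟩ := comb_int A B (Set.Ioi t₀) measurableSet_Ioi
    (fun t ht => ht₀.trans ht) (H_Ioi A B t₀ ht₀ hB) c hc
  rw [← he, integral_Ioi_of_hasDerivAt_of_tendsto'
    (fun x hx => prim_deriv A B c x (lt_of_lt_of_le ht₀ hx)) hi
    (prim_tendsto A B c hc _ (tend_top A B hB)), zero_sub]

lemma ode_Ioc (A B t₀ : ℝ) (ht₀ : 0 < t₀) (hA : A ≠ 0) (c : ℝ) (hc : 0 < c) :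
    2 * MM A B (Set.Ioc 0 t₀) 1 c - 2 * c * MM A B (Set.Ioc 0 t₀) 2 c
      + 8 * c * (A * B) ^ 2 * MM A B (Set.Ioc 0 t₀) 0 c
      = kk A B t₀ * Real.exp (-c * hh A B t₀) := by
  obtain ⟨hi, he⟩ := comb_int A B (Set.Ioc 0 t₀) measurableSet_Ioc
    (fun t ht => ht.1) (H_Ioc A B t₀ hA) c hc
  rw [← he, ← intervalIntegral.integral_of_le ht₀.le,
    intervalIntegral.integral_eq_sub_of_hasDerivAt_of_tendsto ht₀
    (fun x hx => prim_deriv A B c x hx.1)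
    ((intervalIntegrable_iff_integrableOn_Ioc_of_le ht₀.le).2 hi)
    (prim_tendsto A B c hc _ (tend_zero A B hA))
    ((prim_deriv A B c t₀ ht₀).continuousAt.continuousWithinAt), sub_zero]

lemma exp_comb (A B r v t : ℝ) (hr : r ^ 2 = v) (ht : 0 < t) :
    Real.exp (-(2 * π * Q0 (r * A, r * B))) *
      (Real.exp (-(4 * π * (lamM (r * A, r * B) t)^2)) / t)
      = hh A B t ^ 0 * Real.exp (-(π * v) * hh A B t) / t := by
  rw [pow_zero, one_mul, ← mul_div_assoc, ← Real.exp_add]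
  congr 2
  unfold Q0 lamM hh
  rw [← hr]
  field_simp
  ring

/-- Everything about the real function of `v`. -/
lemma core (t₀ : ℝ) (ht₀ : 0 < t₀) (A B : ℝ)
    (hp : lamP (A, B) t₀ ≠ 0) (hm : lamM (A, B) t₀ ≠ 0) :
    ∃ (s : ℝ) (M0 M1 M2 : ℝ → ℝ),
      (∀ v, 0 < v → betaF t₀ (Real.sqrt v * A, Real.sqrt v * B) = s * M0 (π * v)) ∧
      (∀ c, 0 < c → HasDerivAt M0 (-M1 c) c) ∧
      (∀ c, 0 < c → HasDerivAt M1 (-M2 c) c) ∧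
      (∀ c, 0 < c → s * (c * M2 c - M1 c - 4 * c * (A * B) ^ 2 * M0 c) =
        2 * lamP (A, B) t₀ * lamM (A, B) t₀ * Real.exp (-c * hh A B t₀)) := by
  have hk : kk A B t₀ = 4 * (lamM (A, B) t₀ * lamP (A, B) t₀) := by
    unfold kk lamM lamP; field_simp; ring
  have hsc : ∀ v, 0 < v → lamM (Real.sqrt v * A, Real.sqrt v * B) t₀ *
      lamP (Real.sqrt v * A, Real.sqrt v * B) t₀ = v * (lamM (A, B) t₀ * lamP (A, B) t₀) := by
    intro v hv
    have : v = Real.sqrt v * Real.sqrt v := (Real.mul_self_sqrt hv.le).symm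
    conv_rhs => rw [this]
    unfold lamM lamP; field_simp
  rcases lt_or_gt_of_ne (mul_ne_zero hm hp) with hneg | hpos
  · have hA : A ≠ 0 := by
      rintro rfl
      have : 0 ≤ kk 0 B t₀ := by unfold kk; simp; positivity
      linarith
    refine ⟨-1, MM A B (Set.Ioc 0 t₀) 0, MM A B (Set.Ioc 0 t₀) 1, MM A B (Set.Ioc 0 t₀) 2,
      ?_, ?_, ?_, ?_⟩
    · intro v hv
      have h1 : v * (lamM (A, B) t₀ * lamP (A, B) t₀) < 0 := mul_neg_of_pos_of_neg hv hneg
      unfold betaF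
      rw [hsc v hv, if_neg (not_lt.2 h1.le), if_pos h1, ← integral_const_mul, neg_one_mul]
      congr 1
      exact setIntegral_congr_fun measurableSet_Ioc fun t ht =>
        exp_comb A B _ v t (Real.sq_sqrt hv.le) ht.1
    · exact moment_deriv A B _ measurableSet_Ioc (fun t ht => ht.1) (H_Ioc A B t₀ hA) 0
    · exact moment_deriv A B _ measurableSet_Ioc (fun t ht => ht.1) (H_Ioc A B t₀ hA) 1
    · intro c hc
      have := ode_Ioc A B t₀ ht₀ hA c hc
      rw [hk] at this
      linarith
  · have hB : B ≠ 0 := by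
      rintro rfl
      have : kk A 0 t₀ ≤ 0 := by unfold kk; simp; positivity
      linarith
    refine ⟨1, MM A B (Set.Ioi t₀) 0, MM A B (Set.Ioi t₀) 1, MM A B (Set.Ioi t₀) 2,
      ?_, ?_, ?_, ?_⟩
    · intro v hv
      have h1 : 0 < v * (lamM (A, B) t₀ * lamP (A, B) t₀) := mul_pos hv hpos
      unfold betaF
      rw [hsc v hv, if_pos h1, ← integral_const_mul, one_mul]
      exact setIntegral_congr_fun measurableSet_Ioi fun t ht =>
        exp_comb A B _ v t (Real.sq_sqrt hv.le) (ht₀.trans ht)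
    · exact moment_deriv A B _ measurableSet_Ioi (fun t ht => ht₀.trans ht) (H_Ioi A B t₀ ht₀ hB) 0
    · exact moment_deriv A B _ measurableSet_Ioi (fun t ht => ht₀.trans ht) (H_Ioi A B t₀ ht₀ hB) 1
    · intro c hc
      have := ode_Ioi A B t₀ ht₀ hB c hc
      rw [hk] at this
      linarith

lemma real_part (t₀ : ℝ) (ht₀ : 0 < t₀) (A B : ℝ)
    (hp : lamP (A, B) t₀ ≠ 0) (hm : lamM (A, B) t₀ ≠ 0) :
    ∃ g1 g2 : ℝ → ℝ,
      (∀ v, 0 < v → HasDerivAt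
        (fun v => Real.sqrt v * betaF t₀ (Real.sqrt v * A, Real.sqrt v * B)) (g1 v) v) ∧
      (∀ v, 0 < v → HasDerivAt g1 (g2 v) v) ∧
      (∀ v, 0 < v → v ^ 2 * (g2 v - (2 * π * (A * B)) ^ 2 *
          (Real.sqrt v * betaF t₀ (Real.sqrt v * A, Real.sqrt v * B)))
          + Real.sqrt v * betaF t₀ (Real.sqrt v * A, Real.sqrt v * B) / 4
        = 2 * π * lamP (A, B) t₀ * lamM (A, B) t₀ * v ^ ((3:ℝ)/2) *
          Real.exp (-(π * v) * hh A B t₀)) := by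
  obtain ⟨s, M0, M1, M2, hb, d0, d1, ode⟩ := core t₀ ht₀ A B hp hm
  have hpi := Real.pi_pos
  have hlin : ∀ v : ℝ, HasDerivAt (fun v : ℝ => π * v) π v := fun v => by
    simpa using (hasDerivAt_id v).const_mul π
  have e0 : ∀ v, 0 < v → HasDerivAt (fun v => M0 (π * v)) (-M1 (π * v) * π) v := fun v hv =>
    (d0 (π * v) (by positivity)).comp v (hlin v)
  have e1 : ∀ v, 0 < v → HasDerivAt (fun v => M1 (π * v)) (-M2 (π * v) * π) v := fun v hv =>
    (d1 (π * v) (by positivity)).comp v (hlin v)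
  refine ⟨fun v => s * ((2 * Real.sqrt v)⁻¹ * M0 (π * v) - π * (Real.sqrt v * M1 (π * v))),
    fun v => s * (-(4 * v * Real.sqrt v)⁻¹ * M0 (π * v) - π * (Real.sqrt v)⁻¹ * M1 (π * v)
      + π ^ 2 * Real.sqrt v * M2 (π * v)), ?_, ?_, ?_⟩
  · intro v hv
    have hs : HasDerivAt Real.sqrt (1 / (2 * Real.sqrt v)) v := Real.hasDerivAt_sqrt hv.ne'
    have h := (hs.mul (e0 v hv)).const_mul s
    refine (h.congr_deriv ?_).congr_of_eventuallyEq ?_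
    · simp only [one_div]; ring
    · filter_upwards [Ioi_mem_nhds hv] with x hx
      simp only [Pi.mul_apply]
      rw [hb x hx]; ring
  · intro v hv
    have hs : HasDerivAt Real.sqrt (1 / (2 * Real.sqrt v)) v := Real.hasDerivAt_sqrt hv.ne'
    have hr : 0 < Real.sqrt v := Real.sqrt_pos.2 hv
    have hi := (hs.const_mul 2).inv (by positivity)
    have h := ((hi.mul (e0 v hv)).sub ((hs.mul (e1 v hv)).const_mul π)).const_mul s
    refine h.congr_deriv ?_
    obtain ⟨r, hr', rfl⟩ : ∃ r, 0 < r ∧ v = r ^ 2 := ⟨_, hr, (Real.sq_sqrt hv.le).symm⟩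
    simp only [Pi.inv_apply, Real.sqrt_sq hr'.le]
    field_simp
    ring
  · intro v hv
    have hr : 0 < Real.sqrt v := Real.sqrt_pos.2 hv
    have h3 : v ^ ((3:ℝ)/2) = v * Real.sqrt v := by
      rw [Real.sqrt_eq_rpow, show (3:ℝ)/2 = 1 + 1/2 by norm_num, Real.rpow_add hv, Real.rpow_one]
    have o := ode (π * v) (by positivity)
    rw [hb v hv, h3]
    have : 2 * π * lamP (A, B) t₀ * lamM (A, B) t₀ * (v * Real.sqrt v) *
          Real.exp (-(π * v) * hh A B t₀) = π * (v * Real.sqrt v) *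
          (2 * lamP (A, B) t₀ * lamM (A, B) t₀ * Real.exp (-(π * v) * hh A B t₀)) := by ring
    rw [this, ← o]
    clear this o h3
    beta_reduce
    generalize M0 (π * v) = m0
    generalize M1 (π * v) = m1
    generalize M2 (π * v) = m2
    obtain ⟨r, hr', rfl⟩ : ∃ r, 0 < r ∧ v = r ^ 2 := ⟨_, hr, (Real.sq_sqrt hv.le).symm⟩
    simp only [Real.sqrt_sq hr'.le]
    field_simp
    ring

end GtAux

/-- Termwise form of Zwegers' theorem `Δ̃ φ^{c₀}_{L+h} = 2π θ^{(1,1)}_{L+h}(·, t₀)`. -/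
theorem Gterm_laplacian (t₀ : ℝ) (ht₀ : 0 < t₀) (lam : ℝ × ℝ)
    (hp : lamP lam t₀ ≠ 0) (hm : lamM lam t₀ ≠ 0) (u v : ℝ) (hv : 0 < v) :
    (v:ℂ)^2 * (deriv (fun u' : ℝ => deriv (fun u'' : ℝ => Gterm t₀ lam u'' v) u') u
        + deriv (fun v' : ℝ => deriv (fun v'' : ℝ => Gterm t₀ lam u v'') v') v)
      + Gterm t₀ lam u v / 4
      = 2 * (π:ℂ) * (lamP lam t₀ : ℂ) * (lamM lam t₀ : ℂ) * ((v ^ ((3:ℝ)/2) : ℝ) : ℂ) *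
          Complex.exp (2 * (π:ℂ) * Complex.I *
            ((lamP lam t₀ : ℂ)^2 * ((u:ℂ) + (v:ℂ) * Complex.I)
              - (lamM lam t₀ : ℂ)^2 * ((u:ℂ) - (v:ℂ) * Complex.I))) := by
  obtain ⟨A, B⟩ := lam
  obtain ⟨g1, g2, hg1, hg2, hfin⟩ := GtAux.real_part t₀ ht₀ A B hp hm
  have hfin := hfin v hv
  set b : ℝ → ℝ := fun v => Real.sqrt v * betaF t₀ (Real.sqrt v * A, Real.sqrt v * B) with hb
  have hG : ∀ u v, Gterm t₀ (A, B) u v = (b v : ℂ) *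
      Complex.exp (2 * (π:ℂ) * Complex.I * (Q0 (A, B) : ℂ) * (u:ℂ)) := by
    intro u v; simp only [Gterm, hb]; push_cast; ring
  simp only [hG]
  set K : ℂ := 2 * (π:ℂ) * Complex.I * (Q0 (A, B) : ℂ) with hK
  have hE : ∀ u : ℝ, HasDerivAt (fun u : ℝ => Complex.exp (K * (u:ℂ)))
      (K * Complex.exp (K * (u:ℂ))) u := by
    intro u
    have h1 : HasDerivAt (fun u : ℝ => K * (u:ℂ)) (K * 1) u :=
      (HasDerivAt.ofReal_comp (hasDerivAt_id u)).const_mul K |>.congr_deriv (by simp)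
    exact h1.cexp.congr_deriv (by ring)
  have du1 : (fun u' : ℝ => deriv (fun u'' : ℝ => (b v : ℂ) * Complex.exp (K * (u'':ℂ))) u')
      = fun u' : ℝ => (b v : ℂ) * (K * Complex.exp (K * (u':ℂ))) := by
    funext u'
    exact ((hE u').const_mul _).deriv
  have du2 : deriv (fun u' : ℝ => (b v : ℂ) * (K * Complex.exp (K * (u':ℂ)))) u
      = (b v : ℂ) * (K * (K * Complex.exp (K * (u:ℂ)))) :=
    (((hE u).const_mul K).const_mul _).deriv
  have dv : deriv (fun v' : ℝ => deriv (fun v'' : ℝ => (b v'' : ℂ) * Complex.exp (K * (u:ℂ))) v') v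
      = (g2 v : ℂ) * Complex.exp (K * (u:ℂ)) := by
    have h : HasDerivAt (fun v' : ℝ => (g1 v' : ℂ) * Complex.exp (K * (u:ℂ)))
      ((g2 v : ℂ) * Complex.exp (K * (u:ℂ))) v := (hg2 v hv).ofReal_comp.mul_const _
    refine (h.congr_of_eventuallyEq ?_).deriv
    filter_upwards [Ioi_mem_nhds hv] with x hx
    exact ((hg1 x hx).ofReal_comp.mul_const _).deriv
  rw [du1, du2, dv]
  have hK2 : K ^ 2 = -(2 * (π:ℂ) * ((A:ℂ) * B)) ^ 2 := by
    rw [hK]; simp only [Q0]; push_cast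
    linear_combination (4 * (π:ℂ) ^ 2 * ((A:ℂ) * B) ^ 2) * Complex.I_sq
  have hQ : lamP (A, B) t₀ ^ 2 - lamM (A, B) t₀ ^ 2 = Q0 (A, B) := by
    unfold lamP lamM Q0; field_simp; ring
  have hH : GtAux.hh A B t₀ = 2 * (lamP (A, B) t₀ ^ 2 + lamM (A, B) t₀ ^ 2) := by
    unfold lamP lamM GtAux.hh; field_simp; ring
  have hexp : Complex.exp (2 * (π:ℂ) * Complex.I *
            ((lamP (A, B) t₀ : ℂ)^2 * ((u:ℂ) + (v:ℂ) * Complex.I)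
              - (lamM (A, B) t₀ : ℂ)^2 * ((u:ℂ) - (v:ℂ) * Complex.I)))
      = ((Real.exp (-(π * v) * GtAux.hh A B t₀) : ℝ) : ℂ) * Complex.exp (K * (u:ℂ)) := by
    rw [Complex.ofReal_exp, ← Complex.exp_add, hH, hK, ← hQ]
    congr 1
    push_cast
    linear_combination (2 * (π:ℂ) * v * ((lamP (A, B) t₀ : ℂ)^2 + (lamM (A, B) t₀ : ℂ)^2)) *
      Complex.I_sq
  rw [hexp]
  have hfC := congrArg (fun x : ℝ => (x : ℂ)) hfin
  have hbv : Real.sqrt v * betaF t₀ (Real.sqrt v * A, Real.sqrt v * B) = b v := rfl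
  simp only [hbv] at hfC
  push_cast at hfC ⊢
  linear_combination (Complex.exp (K * (u:ℂ))) * hfC +
    ((v:ℂ) ^ 2 * (b v : ℂ) * Complex.exp (K * (u:ℂ))) * hK2
end

section
/- Let ε > 1, t₀ > 0, and λ = (λ₁,λ₂) ∈ ℝ², and set μ := (ε^{−1}·λ₁, ε·λ₂) and m := Q₀(λ). For w ∈ ℝ² write E(w) := exp(−2πv((w_{t₀}^+)² + (w_{t₀}^−)²)) and A(w) := w_{t₀}^+·w_{t₀}^−·E(w). Then the function h(v) := β̃_{t₀}(√v·λ) on v > 0 satisfies v²·h''(v) + v·h'(v) − 4π²m²v²·h(v) = −2πv·log(ε)·A(μ) − 2πv·log(t₀)·(A(μ) − A(λ)) − (1/4)·(E(μ) − E(λ)) for all v > 0. -/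
open Real MeasureTheory

theorem aux_hasDerivAt (a b : ℝ) (G C : ℝ → ℝ) (hG : ContinuousOn G (Set.uIcc a b))
    (hC : ContinuousOn C (Set.uIcc a b)) (v : ℝ) :
    HasDerivAt (fun v : ℝ => ∫ t in a..b, G t * Real.exp (-(v * C t)))
      (∫ t in a..b, (-(C t) * G t) * Real.exp (-(v * C t))) v := by
  have hc : ∀ v : ℝ, ContinuousOn (fun t => G t * Real.exp (-(v * C t))) (Set.uIcc a b) := by
    intro v
    exact hG.mul (Real.continuous_exp.comp_continuousOn (continuousOn_const.mul hC).neg)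
  have hc' : ContinuousOn (fun t => (-(C t) * G t) * Real.exp (-(v * C t))) (Set.uIcc a b) :=
    (hC.neg.mul hG).mul (Real.continuous_exp.comp_continuousOn (continuousOn_const.mul hC).neg)
  have hb : ContinuousOn (fun t => |C t| * |G t| * Real.exp ((|v| + 1) * |C t|)) (Set.uIcc a b) :=
    (hC.abs.mul hG.abs).mul
      (Real.continuous_exp.comp_continuousOn (continuousOn_const.mul hC.abs))
  refine (intervalIntegral.hasDerivAt_integral_of_dominated_loc_of_deriv_le
    (F := fun v t => G t * Real.exp (-(v * C t)))
    (F' := fun v t => (-(C t) * G t) * Real.exp (-(v * C t)))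
    (bound := fun t => |C t| * |G t| * Real.exp ((|v| + 1) * |C t|))
    (Metric.ball_mem_nhds v one_pos) ?_ ?_ ?_ ?_ ?_ ?_).2
  · exact Filter.Eventually.of_forall fun x => (hc x).intervalIntegrable.def'.aestronglyMeasurable
  · exact (hc v).intervalIntegrable
  · exact hc'.intervalIntegrable.def'.aestronglyMeasurable
  · refine Filter.Eventually.of_forall fun t _ x hx => ?_
    rw [Real.norm_eq_abs, abs_mul, abs_mul, abs_neg, Real.abs_exp]
    have hx1 : |x| ≤ |v| + 1 := by
      have h1 : |x - v| < 1 := by simpa [Real.dist_eq] using hx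
      have h2 := abs_sub_abs_le_abs_sub x v
      linarith
    gcongr
    calc -(x * C t) ≤ |x * C t| := neg_le_abs _
      _ = |x| * |C t| := abs_mul _ _
      _ ≤ _ := by gcongr
  · exact hb.intervalIntegrable
  · refine Filter.Eventually.of_forall fun t _ x _ => ?_
    have h1 : HasDerivAt (fun x : ℝ => -(x * C t)) (-(C t)) x := by
      exact ((hasDerivAt_id x).mul_const (C t)).neg.congr_deriv (by simp)
    exact (h1.exp.const_mul (G t)).congr_deriv (by ring)

theorem aux_beta (ε t₀ : ℝ) (hε : 1 < ε) (ht₀ : 0 < t₀) (l : ℝ × ℝ) (v : ℝ) (hv : 0 < v) :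
    betaTilde ε t₀ (Real.sqrt v * l.1, Real.sqrt v * l.2) =
      ∫ t in t₀..(t₀ * ε), (Real.log t / t) *
        Real.exp (-(v * (π * (l.1 ^ 2 / t ^ 2 + l.2 ^ 2 * t ^ 2)))) := by
  unfold betaTilde
  rw [← intervalIntegral.integral_const_mul]
  apply intervalIntegral.integral_congr
  intro t ht
  rw [Set.uIcc_of_le (by nlinarith)] at ht
  have ht0 : t ≠ 0 := (ht₀.trans_le ht.1).ne'
  have hs : Real.sqrt v ^ 2 = v := Real.sq_sqrt hv.le
  have key : -(v * (π * (l.1 ^ 2 / t ^ 2 + l.2 ^ 2 * t ^ 2))) =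
      -(2 * π * Q0 (Real.sqrt v * l.1, Real.sqrt v * l.2)) +
        -(4 * π * (lamM (Real.sqrt v * l.1, Real.sqrt v * l.2) t) ^ 2) := by
    nth_rewrite 1 [← hs]
    unfold Q0 lamM
    field_simp
    ring
  simp only []
  rw [key, Real.exp_add]
  ring

/-- The inhomogeneous ODE satisfied by `h(v) = β̃_{t₀}(√v·λ)`, with `μ = (ε⁻¹λ₁, ελ₂)`,
`E(w) = e^{−2πv((w_{t₀}⁺)² + (w_{t₀}⁻)²)}` and `A(w) = w_{t₀}⁺ w_{t₀}⁻ E(w)`: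
`v²h'' + vh' − 4π²m²v²h = −2πv log(ε) A(μ) − 2πv log(t₀)(A(μ) − A(λ)) − (E(μ) − E(λ))/4`. -/
theorem betaTilde_inhomogeneous_ode (ε t₀ : ℝ) (hε : 1 < ε) (ht₀ : 0 < t₀)
    (lam : ℝ × ℝ) (v : ℝ) (hv : 0 < v) :
    let mu : ℝ × ℝ := (lam.1 / ε, lam.2 * ε)
    let m : ℝ := Q0 lam
    let E : ℝ × ℝ → ℝ := fun w => Real.exp (-(2 * π * v * ((lamP w t₀)^2 + (lamM w t₀)^2)))
    let A : ℝ × ℝ → ℝ := fun w => lamP w t₀ * lamM w t₀ * E w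
    v^2 * deriv (deriv (fun v' : ℝ =>
        betaTilde ε t₀ (Real.sqrt v' * lam.1, Real.sqrt v' * lam.2))) v
      + v * deriv (fun v' : ℝ => betaTilde ε t₀ (Real.sqrt v' * lam.1, Real.sqrt v' * lam.2)) v
      - 4 * π^2 * m^2 * v^2 * betaTilde ε t₀ (Real.sqrt v * lam.1, Real.sqrt v * lam.2)
      = -(2 * π * v * Real.log ε * A mu) - 2 * π * v * Real.log t₀ * (A mu - A lam)
        - (1/4) * (E mu - E lam) := by
  intro mu m E A
  have hle : t₀ ≤ t₀ * ε := by nlinarith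
  have hpos : ∀ t ∈ Set.uIcc t₀ (t₀ * ε), t ≠ 0 := by
    intro t ht
    rw [Set.uIcc_of_le hle] at ht
    exact (ht₀.trans_le ht.1).ne'
  set C : ℝ → ℝ := fun t => π * (lam.1 ^ 2 / t ^ 2 + lam.2 ^ 2 * t ^ 2) with hCdef
  set G : ℝ → ℝ := fun t => Real.log t / t with hGdef
  have hC : ContinuousOn C (Set.uIcc t₀ (t₀ * ε)) := by
    refine continuousOn_const.mul (ContinuousOn.add ?_ (by fun_prop))
    exact continuousOn_const.div (by fun_prop) (fun t ht => pow_ne_zero 2 (hpos t ht))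
  have hG : ContinuousOn G (Set.uIcc t₀ (t₀ * ε)) :=
    (Real.continuousOn_log.mono (fun t ht => hpos t ht)).div continuousOn_id hpos
  set h : ℝ → ℝ := fun v' => betaTilde ε t₀ (Real.sqrt v' * lam.1, Real.sqrt v' * lam.2) with hh
  have hG1 : ContinuousOn (fun t => -(C t) * G t) (Set.uIcc t₀ (t₀ * ε)) := hC.neg.mul hG
  have hev : ∀ x : ℝ, 0 < x → h =ᶠ[nhds x]
      (fun v : ℝ => ∫ t in t₀..(t₀ * ε), G t * Real.exp (-(v * C t))) := by
    intro x hx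
    filter_upwards [lt_mem_nhds hx] with y hy
    exact aux_beta ε t₀ hε ht₀ lam y hy
  have hd1 : ∀ x : ℝ, 0 < x →
      deriv h x = ∫ t in t₀..(t₀ * ε), (-(C t) * G t) * Real.exp (-(x * C t)) := by
    intro x hx
    rw [(hev x hx).deriv_eq]
    exact (aux_hasDerivAt _ _ G C hG hC x).deriv
  have hd2 : deriv (deriv h) v =
      ∫ t in t₀..(t₀ * ε), (-(C t) * (-(C t) * G t)) * Real.exp (-(v * C t)) := by
    have he : deriv h =ᶠ[nhds v]
        (fun x : ℝ => ∫ t in t₀..(t₀ * ε), (-(C t) * G t) * Real.exp (-(x * C t))) := by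
      filter_upwards [lt_mem_nhds hv] with y hy
      exact hd1 y hy
    rw [he.deriv_eq]
    exact (aux_hasDerivAt _ _ _ C hG1 hC v).deriv
  have h0 : betaTilde ε t₀ (Real.sqrt v * lam.1, Real.sqrt v * lam.2) =
      ∫ t in t₀..(t₀ * ε), G t * Real.exp (-(v * C t)) := aux_beta ε t₀ hε ht₀ lam v hv
  have hexp : ContinuousOn (fun t => Real.exp (-(v * C t))) (Set.uIcc t₀ (t₀ * ε)) :=
    Real.continuous_exp.comp_continuousOn (continuousOn_const.mul hC).neg
  have i0 : IntervalIntegrable (fun t => G t * Real.exp (-(v * C t))) volume t₀ (t₀ * ε) :=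
    (hG.mul hexp).intervalIntegrable
  have i1 : IntervalIntegrable (fun t => (-(C t) * G t) * Real.exp (-(v * C t)))
      volume t₀ (t₀ * ε) := (hG1.mul hexp).intervalIntegrable
  have i2 : IntervalIntegrable (fun t => (-(C t) * (-(C t) * G t)) * Real.exp (-(v * C t)))
      volume t₀ (t₀ * ε) := ((hC.neg.mul hG1).mul hexp).intervalIntegrable
  set F : ℝ → ℝ := fun t => -(π * v) * ((lam.2 ^ 2 * t ^ 2 - lam.1 ^ 2 / t ^ 2) / 2) *
      Real.exp (-(v * C t)) * Real.log t - Real.exp (-(v * C t)) / 4 with hF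
  have hFTC := intervalIntegral.integral_eq_sub_of_hasDerivAt (f := F)
    (f' := fun t => v ^ 2 * ((-(C t) * (-(C t) * G t)) * Real.exp (-(v * C t)))
      + v * ((-(C t) * G t) * Real.exp (-(v * C t)))
      - 4 * π ^ 2 * m ^ 2 * v ^ 2 * (G t * Real.exp (-(v * C t)))) (a := t₀) (b := t₀ * ε) ?_
      (((i2.const_mul _).add (i1.const_mul _)).sub (i0.const_mul _))
  · rw [intervalIntegral.integral_sub ((i2.const_mul _).add (i1.const_mul _)) (i0.const_mul _),
      intervalIntegral.integral_add (i2.const_mul _) (i1.const_mul _),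
      intervalIntegral.integral_const_mul, intervalIntegral.integral_const_mul,
      intervalIntegral.integral_const_mul] at hFTC
    rw [hd2, hd1 v hv, h0, hFTC]
    have hε0 : ε ≠ 0 := by positivity
    have e1 : E lam = Real.exp (-(v * C t₀)) := by
      simp only [E, hCdef, lamP, lamM]
      congr 1
      field_simp
      ring
    have e2 : E mu = Real.exp (-(v * C (t₀ * ε))) := by
      simp only [E, hCdef, lamP, lamM, mu]
      congr 1
      field_simp
      ring
    simp only [A, e1, e2, hF, lamP, lamM, mu]
    rw [Real.log_mul ht₀.ne' hε0]
    generalize Real.exp (-(v * C t₀)) = X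
    generalize Real.exp (-(v * C (t₀ * ε))) = Y
    field_simp
    ring
  · intro t ht
    have ht0 := hpos t ht
    have q1 : HasDerivAt (fun t : ℝ => lam.2 ^ 2 * t ^ 2) (lam.2 ^ 2 * (2 * t)) t := by
      simpa using (hasDerivAt_pow 2 t).const_mul (lam.2 ^ 2)
    have q2 : HasDerivAt (fun t : ℝ => lam.1 ^ 2 / t ^ 2) (-2 * lam.1 ^ 2 / t ^ 3) t := by
      refine ((hasDerivAt_const t (lam.1 ^ 2)).div (hasDerivAt_pow 2 t)
        (pow_ne_zero 2 ht0)).congr_deriv ?_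
      simp only [Nat.cast_ofNat]
      field_simp
      ring
    have qE := (((q2.add q1).const_mul π).const_mul v).neg.exp
    have qB := (((q1.sub q2).div_const 2).const_mul (-(π * v)))
    have qF := ((qB.mul qE).mul (Real.hasDerivAt_log ht0)).sub (qE.div_const 4)
    refine qF.congr_deriv ?_
    simp only [hCdef, hGdef, m, Q0, Pi.add_apply, Pi.sub_apply, Pi.mul_apply, Pi.neg_apply]
    generalize Real.exp _ = X
    field_simp
    ring
end

section
/- Let ε > 1 and let f : (0,∞) → ℂ be continuous with f(ε·t) = f(t) for all t > 0. Then for all 0 < t₁ < t₂, ∫_{t₁}^{ε·t₁} f(t)·log(t) dt/t − ∫_{t₂}^{ε·t₂} f(t)·log(t) dt/t = −log(ε)·∫_{t₁}^{t₂} f(t) dt/t. (Applied to the Γ_L-invariant Siegel theta kernel, this gives the identity −log(ε_L)·ϑ̂^{c₁,c₂}_{L+h} = ϑ̃^{c₁}_{L+h} − ϑ̃^{c₂}_{L+h} expressing the completed mock Maass theta function as a difference of two functions depending only on c₁ and c₂ respectively.) -/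
open Real MeasureTheory

/-- For `ε > 1` and a continuous `ε`-invariant function `f` on `(0,∞)`:
`∫_{t₁}^{εt₁} f(t) log t dt/t − ∫_{t₂}^{εt₂} f(t) log t dt/t = −log ε ∫_{t₁}^{t₂} f(t) dt/t`. -/
theorem invariant_log_integral_identity (ε : ℝ) (hε : 1 < ε) (f : ℝ → ℂ)
    (hf : ContinuousOn f (Set.Ioi 0)) (hinv : ∀ t : ℝ, 0 < t → f (ε * t) = f t)
    (t₁ t₂ : ℝ) (ht₁ : 0 < t₁) (ht₁₂ : t₁ < t₂) :
    (∫ t in t₁..(ε * t₁), f t * ((Real.log t / t : ℝ) : ℂ))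
      - (∫ t in t₂..(ε * t₂), f t * ((Real.log t / t : ℝ) : ℂ))
      = -(Real.log ε : ℂ) * ∫ t in t₁..t₂, f t * ((1 / t : ℝ) : ℂ) := by
  have hε0 : 0 < ε := by linarith
  have ht₂ : 0 < t₂ := by linarith
  have hlog : ContinuousOn (fun t : ℝ => Real.log t / t) (Set.Ioi 0) := by
    apply ContinuousOn.div _ continuousOn_id
    · intro x hx; exact ne_of_gt hx
    · exact Real.continuousOn_log.mono (fun x hx => ne_of_gt hx)
  have hinvc : ContinuousOn (fun t : ℝ => 1 / t) (Set.Ioi 0) := by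
    apply ContinuousOn.div continuousOn_const continuousOn_id
    intro x hx; exact ne_of_gt hx
  have hsub : ∀ a b : ℝ, 0 < a → 0 < b → Set.uIcc a b ⊆ Set.Ioi 0 := by
    intro a b ha hb x hx
    exact lt_of_lt_of_le (lt_min ha hb) hx.1
  have hg : ∀ a b : ℝ, 0 < a → 0 < b →
      IntervalIntegrable (fun t => f t * ((Real.log t / t : ℝ) : ℂ)) volume a b := by
    intro a b ha hb
    apply ContinuousOn.intervalIntegrable
    exact (hf.mul (Complex.continuous_ofReal.comp_continuousOn hlog)).mono (hsub a b ha hb)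
  have hh : IntervalIntegrable (fun t => f t * ((1 / t : ℝ) : ℂ)) volume t₁ t₂ := by
    apply ContinuousOn.intervalIntegrable
    exact (hf.mul (Complex.continuous_ofReal.comp_continuousOn hinvc)).mono (hsub t₁ t₂ ht₁ ht₂)
  have e1 : 0 < ε * t₁ := by positivity
  have e2 : 0 < ε * t₂ := by positivity
  rw [intervalIntegral.integral_interval_sub_interval_comm (hg _ _ ht₁ e1) (hg _ _ ht₂ e2)
    (hg _ _ ht₁ ht₂)]
  have key : (∫ t in (ε * t₁)..(ε * t₂), f t * ((Real.log t / t : ℝ) : ℂ))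
      = ∫ t in t₁..t₂, ((Real.log ε : ℂ) * (f t * ((1 / t : ℝ) : ℂ))
          + f t * ((Real.log t / t : ℝ) : ℂ)) := by
    rw [← intervalIntegral.smul_integral_comp_mul_left, ← intervalIntegral.integral_smul]
    apply intervalIntegral.integral_congr
    intro t ht
    have ht0 : 0 < t := hsub t₁ t₂ ht₁ ht₂ ht
    have c1 : (ε : ℂ) ≠ 0 := by exact_mod_cast hε0.ne'
    have c2 : (t : ℂ) ≠ 0 := by exact_mod_cast ht0.ne'
    simp only [hinv t ht0, Real.log_mul hε0.ne' ht0.ne', Complex.real_smul]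
    push_cast
    field_simp
  rw [key, intervalIntegral.integral_add (hh.const_mul _) (hg _ _ ht₁ ht₂),
    intervalIntegral.integral_const_mul]
  ring
end

section
/- For every u ∈ ℝ and v > 0, with λ(m,n) := 6m + 2√6·n + 1/2 and λ'(m,n) := 6m − 2√6·n + 1/2 for (m,n) ∈ ℤ², the family ((λ'(m,n)² − λ(m,n)²)/24)·exp(2πi·λ(m,n)·λ'(m,n)·u/6)·exp(−2πv·(λ(m,n)² + λ'(m,n)²)/12) indexed by (m,n) ∈ ℤ² is summable, and its sum is 0. (This is the vanishing of the theta function θ^{(1,1)}_{L+1/2}(τ, 1) for the lattice L = 6ℤ + 2√6·ℤ in ℚ(√6) underlying Cohen's example, caused by the sign change of the summand under the Galois conjugation λ ↦ λ'.) -/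
open Real

lemma aux_summable (v α β : ℝ) (hv : 0 < v) (hα : α ≠ 0) :
    Summable (fun m : ℤ => |α * m + β| * Real.exp (-(π * v / 3 * (α * m + β)^2))) := by
  have hT : 0 < v / 3 * α^2 := by positivity
  have h1 := (summable_pow_mul_jacobiTheta₂_term_bound (v / 3 * |α * β|) hT 1).mul_left |α|
  have h0 := (summable_pow_mul_jacobiTheta₂_term_bound (v / 3 * |α * β|) hT 0).mul_left |β|
  refine Summable.of_nonneg_of_le (fun m => by positivity) (fun m => ?_) (h1.add h0)
  have ha : |α * m + β| ≤ |α| * |(m:ℝ)| + |β| := by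
    rw [← abs_mul]; exact abs_add_le _ _
  have he : Real.exp (-(π * v / 3 * (α * m + β)^2)) ≤
      Real.exp (-π * (v / 3 * α^2 * (m:ℝ)^2 - 2 * (v / 3 * |α * β|) * |(m:ℝ)|)) := by
    apply Real.exp_le_exp.mpr
    have h3 : -(α * β * m) ≤ |α * β| * |(m:ℝ)| := by
      rw [← abs_mul]; exact neg_le_abs _
    have hp : 0 < π * v := by positivity
    nlinarith [mul_le_mul_of_nonneg_left h3 hp.le, mul_nonneg hp.le (sq_nonneg β)]
  calc _ ≤ (|α| * |(m:ℝ)| + |β|) * Real.exp (-π * (v / 3 * α^2 * (m:ℝ)^2 - 2 * (v / 3 * |α * β|) * |(m:ℝ)|)) := by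
        gcongr
    _ = _ := by push_cast; ring

/-- Vanishing of the theta function `θ^{(1,1)}_{L+1/2}(τ,1)` for the lattice
`L = 6ℤ + 2√6ℤ` in `ℚ(√6)` underlying Cohen's example: with `λ = 6m + 2√6n + 1/2`
and `λ' = 6m − 2√6n + 1/2`, the family
`((λ'² − λ²)/24) e(λλ'u/6) e^{−2πv(λ² + λ'²)/12}` over `(m,n) ∈ ℤ²` is summable
with sum `0`. -/
theorem theta11_cohen_vanishes (u v : ℝ) (hv : 0 < v) :
    Summable (fun p : ℤ × ℤ =>
      let lam : ℝ := 6 * p.1 + 2 * Real.sqrt 6 * p.2 + 1/2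
      let lam' : ℝ := 6 * p.1 - 2 * Real.sqrt 6 * p.2 + 1/2
      (((lam'^2 - lam^2) / 24 : ℝ) : ℂ) *
        Complex.exp (2 * (π:ℂ) * Complex.I * ((lam * lam' * u / 6 : ℝ) : ℂ)) *
        ((Real.exp (-(2 * π * v * (lam^2 + lam'^2) / 12)) : ℝ) : ℂ)) ∧
    (∑' p : ℤ × ℤ,
      let lam : ℝ := 6 * p.1 + 2 * Real.sqrt 6 * p.2 + 1/2
      let lam' : ℝ := 6 * p.1 - 2 * Real.sqrt 6 * p.2 + 1/2
      (((lam'^2 - lam^2) / 24 : ℝ) : ℂ) *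
        Complex.exp (2 * (π:ℂ) * Complex.I * ((lam * lam' * u / 6 : ℝ) : ℂ)) *
        ((Real.exp (-(2 * π * v * (lam^2 + lam'^2) / 12)) : ℝ) : ℂ)) = 0 := by
  constructor
  · have h := (aux_summable v 6 (1/2) hv (by norm_num)).mul_of_nonneg
      (aux_summable v (2 * Real.sqrt 6) 0 hv (by positivity))
      (fun m => by positivity) (fun m => by positivity)
    refine Summable.of_norm ((h.mul_left (1/6)).congr fun p => ?_)
    have hn : ∀ x : ℝ, ‖Complex.exp (2 * (π:ℂ) * Complex.I * (x : ℂ))‖ = 1 := by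
      intro x
      have : 2 * (π:ℂ) * Complex.I * (x : ℂ) = ((2 * π * x : ℝ) : ℂ) * Complex.I := by
        push_cast; ring
      rw [this, Complex.norm_exp_ofReal_mul_I]
    simp only [norm_mul, hn, Complex.norm_real, Real.norm_eq_abs, Real.abs_exp, mul_one]
    generalize Real.sqrt 6 = s
    have e1 : ((6 * (p.1:ℝ) - 2 * s * p.2 + 1/2)^2 - (6 * (p.1:ℝ) + 2 * s * p.2 + 1/2)^2) / 24
        = -((1/6) * ((6 * p.1 + 1/2) * (2 * s * p.2 + 0))) := by ring
    have e2 : -(2 * π * v * ((6 * (p.1:ℝ) + 2 * s * p.2 + 1/2)^2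
          + (6 * (p.1:ℝ) - 2 * s * p.2 + 1/2)^2) / 12)
        = -(π * v / 3 * (6 * p.1 + 1/2)^2) + -(π * v / 3 * (2 * s * p.2 + 0)^2) := by ring
    rw [e1, e2, Real.exp_add, abs_neg, abs_mul, abs_mul, abs_of_pos (by norm_num : (0:ℝ) < 1/6)]
    ring
  · rw [← self_eq_neg, ← tsum_neg]
    conv_lhs => rw [← ((Equiv.refl ℤ).prodCongr (Equiv.neg ℤ)).tsum_eq]
    refine tsum_congr fun p => ?_
    simp only [Equiv.prodCongr_apply, Prod.map, Equiv.refl_apply, Equiv.neg_apply, Int.cast_neg,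
      mul_neg, sub_neg_eq_add, ← sub_eq_add_neg]
    generalize 6 * (p.1:ℝ) + 2 * Real.sqrt 6 * p.2 + 1/2 = x
    generalize 6 * (p.1:ℝ) - 2 * Real.sqrt 6 * p.2 + 1/2 = y
    rw [mul_comm y x, add_comm (y^2) (x^2)]
    push_cast
    ring
end
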